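/- arXiv:math/9909169 — 5 statements merged into one kernel-verified Lean document; each statement's English description precedes it below -/
import Mathlib

section
/- Suppose all the probabilities are distinct: p₁ > p₂ > ⋯ > p_k. Then the expected value of ℓ_N satisfies E(ℓ_N) = N p₁ + Σ_{j=2}^k p_j/(p₁ − p_j) + O(N^{−1/2}) as N → ∞; that is, there is a constant C such that |E(ℓ_N) − N p₁ − Σ_{j=2}^k p_j/(p₁−p_j)| ≤ C N^{−1/2} for all N ≥ 1. -/
open MeasureTheory Filter
open scoped Classical

noncomputable section

/-- Length of the longest weakly increasing subsequence of the word `w`. -/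
def lisLen {k N : ℕ} (w : Fin N → Fin k) : ℕ :=
  (Finset.univ.filter fun s : Finset (Fin N) =>
    ∀ i ∈ s, ∀ j ∈ s, i ≤ j → w i ≤ w j).sup Finset.card

/-- Probability of the event `E` of words of length `N` under the i.i.d. measure
in which letter `i` has probability `p i`. -/
def wordProb (k N : ℕ) (p : Fin k → ℝ) (E : Set (Fin N → Fin k)) : ℝ :=
  ∑ w : Fin N → Fin k, E.indicator (fun w => ∏ i, p (w i)) w

/-- `T` is a semistandard Young tableau of shape `l` with entries in `{0,...,k-1}`. -/
def IsSSYT (k : ℕ) (l : Fin k → ℕ) (T : Fin k × ℕ → ℕ) : Prop :=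
  (∀ (i : Fin k) (j1 j2 : ℕ), j1 ≤ j2 → j2 < l i → T (i, j1) ≤ T (i, j2)) ∧
  (∀ (i1 i2 : Fin k) (j : ℕ), i1 < i2 → j < l i2 → T (i1, j) < T (i2, j)) ∧
  (∀ (i : Fin k) (j : ℕ), j < l i → T (i, j) < k) ∧
  (∀ (i : Fin k) (j : ℕ), l i ≤ j → T (i, j) = 0)

/-- The Schur polynomial `s_l(x)`, as the generating function of SSYT of shape `l`. -/
def schur (k : ℕ) (l : Fin k → ℕ) (x : Fin k → ℝ) : ℝ :=
  ∑ᶠ T ∈ {T | IsSSYT k l T}, ∏ v : Fin k,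
    x v ^ ({c : Fin k × ℕ | c.2 < l c.1 ∧ T c = (v : ℕ)}.ncard)

/-- `T` is a standard Young tableau of shape `l ⊢ N` (entries `0,...,N-1`, each once). -/
def IsSYT (k N : ℕ) (l : Fin k → ℕ) (T : Fin k × ℕ → ℕ) : Prop :=
  (∀ (i : Fin k) (j1 j2 : ℕ), j1 < j2 → j2 < l i → T (i, j1) < T (i, j2)) ∧
  (∀ (i1 i2 : Fin k) (j : ℕ), i1 < i2 → j < l i2 → T (i1, j) < T (i2, j)) ∧
  (∀ (i : Fin k) (j : ℕ), l i ≤ j → T (i, j) = 0) ∧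
  Set.BijOn T {c : Fin k × ℕ | c.2 < l c.1} (Set.Iio N)

/-- `f^l`: the number of standard Young tableaux of shape `l ⊢ N`. -/
def sytCount (k N : ℕ) (l : Fin k → ℕ) : ℕ := {T | IsSYT k N l T}.ncard

/-- The multinomial probability of the outcome `l` in `N` trials. -/
def multProb (k N : ℕ) (p : Fin k → ℝ) (l : Fin k → ℕ) : ℝ :=
  ((N.factorial : ℝ) / ∏ i, ((l i).factorial : ℝ)) * ∏ i, p i ^ l i

/-- The mean of `lisLen` over random words of length `N`. -/
def wordMean (k N : ℕ) (p : Fin k → ℝ) : ℝ :=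
  ∑ w : Fin N → Fin k, (∏ i, p (w i)) * (lisLen w : ℝ)

/-- The variance of `lisLen` over random words of length `N`. -/
def wordVar (k N : ℕ) (p : Fin k → ℝ) : ℝ :=
  ∑ w : Fin N → Fin k, (∏ i, p (w i)) * ((lisLen w : ℝ) - wordMean k N p) ^ 2


/-- Length of the longest weakly increasing subsequence of `w` with letters at most `j`. -/
def lisUpTo {k N : ℕ} (w : Fin N → Fin k) (j : Fin k) : ℕ :=
  (Finset.univ.filter fun s : Finset (Fin N) =>
    (∀ i ∈ s, w i ≤ j) ∧ ∀ i ∈ s, ∀ i' ∈ s, i ≤ i' → w i ≤ w i').sup Finset.card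

lemma card_le_lisUpTo {k N : ℕ} {w : Fin N → Fin k} {j : Fin k} {s : Finset (Fin N)}
    (h₁ : ∀ i ∈ s, w i ≤ j) (h₂ : ∀ i ∈ s, ∀ i' ∈ s, i ≤ i' → w i ≤ w i') :
    s.card ≤ lisUpTo w j :=
  Finset.le_sup (f := Finset.card) (by simpa using ⟨h₁, h₂⟩)

lemma lisUpTo_le {k N : ℕ} {w : Fin N → Fin k} {j : Fin k} {n : ℕ}
    (h : ∀ s : Finset (Fin N), (∀ i ∈ s, w i ≤ j) →
      (∀ i ∈ s, ∀ i' ∈ s, i ≤ i' → w i ≤ w i') → s.card ≤ n) :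
    lisUpTo w j ≤ n := by
  refine Finset.sup_le fun s hs => ?_
  rw [Finset.mem_filter] at hs
  exact h s hs.2.1 hs.2.2

lemma lisUpTo_last {m N : ℕ} (w : Fin N → Fin (m + 1)) :
    lisUpTo w (Fin.last m) = lisLen w := by
  simp [lisUpTo, lisLen, Fin.le_last]

lemma lisUpTo_snoc {k N : ℕ} (w : Fin N → Fin k) (x j : Fin k) :
    lisUpTo (Fin.snoc (α := fun _ => Fin k) w x) j =
      if x ≤ j then max (lisUpTo w j) (lisUpTo w x + 1) else lisUpTo w j := by
  have lift : lisUpTo w j ≤ lisUpTo (Fin.snoc (α := fun _ => Fin k) w x) j := by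
    refine lisUpTo_le fun s h₁ h₂ => ?_
    rw [← Finset.card_map Fin.castSuccEmb]
    apply card_le_lisUpTo
    · simpa using h₁
    · simpa using h₂
  apply le_antisymm
  · refine lisUpTo_le fun s h₁ h₂ => ?_
    set t : Finset (Fin N) := Finset.univ.filter fun i => i.castSucc ∈ s with ht
    have t₂ : ∀ i ∈ t, ∀ i' ∈ t, i ≤ i' → w i ≤ w i' := by
      intro i hi i' hi' hle
      simpa using h₂ i.castSucc (by simpa [ht] using hi) i'.castSucc
        (by simpa [ht] using hi') (by simpa using hle)
    have t₁ : ∀ i ∈ t, w i ≤ j := by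
      intro i hi
      simpa using h₁ i.castSucc (by simpa [ht] using hi)
    by_cases hl : Fin.last N ∈ s
    · have hx : x ≤ j := by simpa using h₁ _ hl
      have hs : s ⊆ insert (Fin.last N) (t.map Fin.castSuccEmb) := by
        intro i hi
        induction i using Fin.lastCases with
        | last => simp
        | cast i => simp [ht, hi]
      have t₃ : ∀ i ∈ t, w i ≤ x := by
        intro i hi
        simpa using h₂ i.castSucc (by simpa [ht] using hi) _ hl (Fin.le_last _)
      rw [if_pos hx]
      refine le_max_of_le_right ((Finset.card_le_card hs).trans
        ((Finset.card_insert_le _ _).trans ?_))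
      rw [Finset.card_map]
      exact Nat.succ_le_succ (card_le_lisUpTo t₃ t₂)
    · have hs : s ⊆ t.map Fin.castSuccEmb := by
        intro i hi
        induction i using Fin.lastCases with
        | last => exact absurd hi hl
        | cast i => simp [ht, hi]
      have hc : s.card ≤ lisUpTo w j := by
        refine (Finset.card_le_card hs).trans ?_
        rw [Finset.card_map]
        exact card_le_lisUpTo t₁ t₂
      split_ifs
      · exact le_max_of_le_left hc
      · exact hc
  · split_ifs with hx
    · refine max_le lift ?_
      obtain ⟨n, hn⟩ : ∃ n, lisUpTo (Fin.snoc (α := fun _ => Fin k) w x) j = n := ⟨_, rfl⟩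
      have hpos : 1 ≤ n := by
        rw [← hn]
        refine (Finset.card_singleton (Fin.last N)).symm.le.trans (card_le_lisUpTo ?_ ?_)
        · simpa using hx
        · simp
      suffices lisUpTo w x ≤ n - 1 by omega
      refine lisUpTo_le fun s h₁ h₂ => ?_
      suffices (insert (Fin.last N) (s.map Fin.castSuccEmb)).card ≤ n by
        rw [Finset.card_insert_of_notMem (by simp), Finset.card_map] at this
        omega
      rw [← hn]
      apply card_le_lisUpTo
      · intro i hi
        rcases Finset.mem_insert.1 hi with rfl | hi
        · simpa using hx
        · obtain ⟨a, ha, rfl⟩ := Finset.mem_map.1 hi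
          simpa using (h₁ a ha).trans hx
      · intro i hi i' hi' hle
        rcases Finset.mem_insert.1 hi with rfl | hi <;>
          rcases Finset.mem_insert.1 hi' with rfl | hi'
        · exact le_rfl
        · obtain ⟨a, ha, rfl⟩ := Finset.mem_map.1 hi'
          exact absurd hle (by simp [Fin.le_def])
        · obtain ⟨a, ha, rfl⟩ := Finset.mem_map.1 hi
          simpa using h₁ a ha
        · obtain ⟨a, ha, rfl⟩ := Finset.mem_map.1 hi
          obtain ⟨b, hb, rfl⟩ := Finset.mem_map.1 hi'
          simpa using h₂ a ha b hb (by simpa using hle)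
    · exact lift

/-- Update, on appending the letter `x`, of the vector of excesses of `lisUpTo` over the
number of letters `0`. -/
def excessStep {m : ℕ} (x : Fin (m + 1)) (g : Fin (m + 1) → ℕ) : Fin (m + 1) → ℕ :=
  fun j => if x = 0 then g j - 1 else if x ≤ j then max (g j) (g x + 1) else g j

/-- The excess vector after reading the word `w` from the initial state `g`. -/
def excessRun {m : ℕ} (g : Fin (m + 1) → ℕ) : {N : ℕ} → (Fin N → Fin (m + 1)) →
    (Fin (m + 1) → ℕ)
  | 0, _ => g
  | _ + 1, w => excessStep (w (Fin.last _)) (excessRun g (Fin.init w))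

lemma excessRun_snoc {m N : ℕ} (g : Fin (m + 1) → ℕ) (w : Fin N → Fin (m + 1))
    (x : Fin (m + 1)) :
    excessRun g (Fin.snoc (α := fun _ => Fin (m + 1)) w x) = excessStep x (excessRun g w) := by
  simp [excessRun]

lemma excessStep_zero {m : ℕ} (x : Fin (m + 1)) {g : Fin (m + 1) → ℕ} (hg : g 0 = 0) :
    excessStep x g 0 = 0 := by
  unfold excessStep
  split_ifs with h h'
  · omega
  · exact absurd (Fin.le_zero_iff.1 h') h
  · exact hg

lemma excessRun_zero {m N : ℕ} (w : Fin N → Fin (m + 1)) {g : Fin (m + 1) → ℕ}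
    (hg : g 0 = 0) : excessRun g w 0 = 0 := by
  induction N with
  | zero => exact hg
  | succ N ih => exact excessStep_zero _ (ih _)

lemma excessStep_mono {m : ℕ} (x : Fin (m + 1)) : Monotone (excessStep x) := by
  intro g g' h j
  have hj : g j ≤ g' j := h j
  have hx : g x ≤ g' x := h x
  unfold excessStep
  dsimp only
  split_ifs <;> omega

lemma excessRun_mono {m N : ℕ} (w : Fin N → Fin (m + 1)) :
    Monotone fun g => excessRun g w := by
  induction N with
  | zero => exact fun g g' h => h
  | succ N ih => exact fun g g' h => excessStep_mono _ (ih (Fin.init w) h)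

/-- The number of letters `0` in `w`. -/
def zeroCount {m N : ℕ} (w : Fin N → Fin (m + 1)) : ℕ := ∑ i, if w i = 0 then 1 else 0

lemma zeroCount_snoc {m N : ℕ} (w : Fin N → Fin (m + 1)) (x : Fin (m + 1)) :
    zeroCount (Fin.snoc (α := fun _ => Fin (m + 1)) w x) =
      zeroCount w + if x = 0 then 1 else 0 := by
  unfold zeroCount
  rw [Fin.sum_univ_castSucc]
  simp only [Fin.snoc_castSucc, Fin.snoc_last]

lemma lisUpTo_eq_excessRun {m N : ℕ} (w : Fin N → Fin (m + 1)) (j : Fin (m + 1)) :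
    lisUpTo w j = excessRun 0 w j + zeroCount w := by
  induction N generalizing j with
  | zero =>
    simp only [excessRun, zeroCount, Finset.univ_eq_empty, Finset.sum_empty, Pi.zero_apply]
    exact Nat.le_zero.1 (lisUpTo_le fun s _ _ => by simp [Finset.eq_empty_of_isEmpty s])
  | succ N ih =>
    obtain ⟨w, x, rfl⟩ : ∃ (v : Fin N → Fin (m + 1)) (x : Fin (m + 1)),
        w = Fin.snoc (α := fun _ => Fin (m + 1)) v x :=
      ⟨Fin.init w, w (Fin.last N), by simp⟩
    have h0 : excessRun 0 w 0 = 0 := excessRun_zero w rfl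
    rw [lisUpTo_snoc, excessRun_snoc, zeroCount_snoc, ih, ih]
    unfold excessStep
    by_cases hx : x = 0
    · subst hx
      simp only [Fin.zero_le, if_true, h0]
      omega
    · simp only [hx, if_false]
      split_ifs <;> omega

/-- Expectation of `Φ` over random words of length `N`. -/
def wordAvg {k N : ℕ} (p : Fin k → ℝ) (Φ : (Fin N → Fin k) → ℝ) : ℝ :=
  ∑ w : Fin N → Fin k, (∏ i, p (w i)) * Φ w

lemma wordAvg_zero {k : ℕ} (p : Fin k → ℝ) (Φ : (Fin 0 → Fin k) → ℝ) :
    wordAvg p Φ = Φ Fin.elim0 := by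
  simp [wordAvg, Subsingleton.elim (default : Fin 0 → Fin k) Fin.elim0]

lemma wordAvg_succ {k N : ℕ} (p : Fin k → ℝ) (Φ : (Fin (N + 1) → Fin k) → ℝ) :
    wordAvg p Φ = wordAvg p fun w : Fin N → Fin k =>
      ∑ x, p x * Φ (Fin.snoc (α := fun _ => Fin k) w x) := by
  unfold wordAvg
  rw [← (Fin.snocEquiv fun _ : Fin (N + 1) => Fin k).sum_comp, Fintype.sum_prod_type_right]
  refine Finset.sum_congr rfl fun w _ => ?_
  rw [Finset.mul_sum]
  refine Finset.sum_congr rfl fun x _ => ?_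
  simp [Fin.snocEquiv, Fin.prod_univ_castSucc, mul_assoc]

lemma wordAvg_mono {k N : ℕ} {p : Fin k → ℝ} (hp : ∀ i, 0 < p i)
    {Φ Ψ : (Fin N → Fin k) → ℝ} (h : ∀ w, Φ w ≤ Ψ w) : wordAvg p Φ ≤ wordAvg p Ψ :=
  Finset.sum_le_sum fun w _ =>
    mul_le_mul_of_nonneg_left (h w) (Finset.prod_nonneg fun _ _ => (hp _).le)

lemma wordAvg_add {k N : ℕ} (p : Fin k → ℝ) (Φ Ψ : (Fin N → Fin k) → ℝ) :
    wordAvg p (fun w => Φ w + Ψ w) = wordAvg p Φ + wordAvg p Ψ := by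
  simp [wordAvg, mul_add, Finset.sum_add_distrib]

lemma wordAvg_const_mul {k N : ℕ} (p : Fin k → ℝ) (c : ℝ) (Φ : (Fin N → Fin k) → ℝ) :
    wordAvg p (fun w => c * Φ w) = c * wordAvg p Φ := by
  simp only [wordAvg, Finset.mul_sum]
  exact Finset.sum_congr rfl fun w _ => by ring

lemma wordAvg_const {k N : ℕ} {p : Fin k → ℝ} (hsum : ∑ i, p i = 1) (c : ℝ) :
    wordAvg p (fun _ : Fin N → Fin k => c) = c := by
  induction N with
  | zero => exact wordAvg_zero _ _
  | succ N ih => rw [wordAvg_succ]; simpa [← Finset.sum_mul, hsum] using ih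

lemma wordAvg_zeroCount {m : ℕ} {p : Fin (m + 1) → ℝ} (hsum : ∑ i, p i = 1) (N : ℕ) :
    wordAvg p (fun w : Fin N → Fin (m + 1) => (zeroCount w : ℝ)) = N * p 0 := by
  induction N with
  | zero => simp [wordAvg_zero, zeroCount]
  | succ N ih =>
    have hc (w : Fin N → Fin (m + 1)) :
        ∑ x, p x * (zeroCount (Fin.snoc (α := fun _ => Fin (m + 1)) w x) : ℝ) =
          zeroCount w + p 0 := by
      simp [zeroCount_snoc, mul_add, Finset.sum_add_distrib, ← Finset.sum_mul, hsum]
    rw [wordAvg_succ]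
    simp only [hc]
    rw [wordAvg_add, ih, wordAvg_const hsum]
    push_cast
    ring

lemma wordMean_eq {m : ℕ} {p : Fin (m + 1) → ℝ} (hsum : ∑ i, p i = 1) (N : ℕ) :
    wordMean (m + 1) N p = N * p 0 +
      wordAvg p fun w : Fin N → Fin (m + 1) => (excessRun 0 w (Fin.last m) : ℝ) := by
  rw [← wordAvg_zeroCount hsum, ← wordAvg_add]
  unfold wordMean wordAvg
  refine Finset.sum_congr rfl fun w _ => ?_
  rw [← lisUpTo_last, lisUpTo_eq_excessRun]
  push_cast
  ring

lemma pow_excessStep_sub_le {m : ℕ} {θ : ℝ} (hθ : 1 ≤ θ) {g g' : Fin (m + 1) → ℕ}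
    (h : g' ≤ g) (h0 : g 0 = 0) (x j : Fin (m + 1)) :
    θ ^ excessStep x g j - θ ^ excessStep x g' j ≤
      (θ ^ g j - θ ^ g' j) + (if x = 0 then (θ⁻¹ - 1) * (θ ^ g j - θ ^ g' j) else 0) +
      (if x = j then (θ - 1) * (θ ^ g j - θ ^ g' j) else 0) +
      θ * (if x < j then θ ^ g x - θ ^ g' x else 0) := by
  have hθ0 : 0 < θ := by linarith
  have hnn (i) : θ ^ g' i ≤ θ ^ g i := pow_le_pow_right₀ hθ (h i)
  have h0' : g' 0 = 0 := Nat.le_zero.1 ((h 0).trans h0.le)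
  by_cases hx : x = 0
  · subst hx
    have hz : (if (0 : Fin (m + 1)) = j then (θ - 1) * (θ ^ g j - θ ^ g' j) else 0) = 0 := by
      split_ifs with hj
      · simp [← hj, h0, h0']
      · rfl
    rw [hz]
    simp only [excessStep, if_true, h0, h0', sub_self, ite_self, mul_zero, add_zero]
    have key : ∀ a b : ℕ, b ≤ a → θ ^ (a - 1) - θ ^ (b - 1) ≤ θ⁻¹ * (θ ^ a - θ ^ b) := by
      intro a b hab
      rcases a with _ | a
      · simp [Nat.le_zero.1 hab]
      · rcases b with _ | b
        · have : θ⁻¹ ≤ 1 := inv_le_one_of_one_le₀ hθ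
          rw [pow_succ, mul_sub, mul_comm (θ ^ a), inv_mul_cancel_left₀ hθ0.ne']
          simp only [Nat.add_sub_cancel, pow_zero, Nat.zero_sub, mul_one]
          linarith
        · simp only [Nat.add_sub_cancel]
          rw [pow_succ, pow_succ, ← sub_mul, mul_comm _ θ, inv_mul_cancel_left₀ hθ0.ne']
    linarith [key _ _ (h j)]
  · rw [if_neg hx]
    simp only [excessStep, hx, if_false]
    rcases lt_trichotomy x j with hxj | rfl | hxj
    · rw [if_neg hxj.ne, if_pos hxj, if_pos hxj.le, if_pos hxj.le]
      have e₁ : θ ^ g' j ≤ θ ^ max (g' j) (g' x + 1) := pow_le_pow_right₀ hθ (le_max_left _ _)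
      have e₂ : θ ^ (g' x + 1) ≤ θ ^ max (g' j) (g' x + 1) :=
        pow_le_pow_right₀ hθ (le_max_right _ _)
      rw [pow_succ] at e₂
      have := mul_le_mul_of_nonneg_left (hnn x) hθ0.le
      have := hnn j
      rcases max_choice (g j) (g x + 1) with e | e <;> rw [e]
      · linarith
      · rw [pow_succ]; linarith
    · simp only [le_refl, if_true, lt_irrefl, if_false]
      rw [max_eq_right (Nat.le_succ _), max_eq_right (Nat.le_succ _), pow_succ, pow_succ]
      linarith
    · simp [hxj.ne', not_lt.2 hxj.le, not_le.2 hxj]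

/-- Weighted distance between two ordered excess vectors. -/
def excessGap {m : ℕ} (θ ε : ℝ) (g g' : Fin (m + 1) → ℕ) : ℝ :=
  ∑ j : Fin (m + 1), ε ^ (j : ℕ) * (θ ^ g j - θ ^ g' j)

lemma sum_excessGap_step_le {m : ℕ} {p : Fin (m + 1) → ℝ} (hp : ∀ i, 0 < p i)
    (hsum : ∑ i, p i = 1) {q θ ε : ℝ} (hθ : 1 ≤ θ) (hε : 0 ≤ ε) (hε1 : ε ≤ 1)
    (hq : ∀ j, j ≠ 0 → p j ≤ q) {g g' : Fin (m + 1) → ℕ} (h : g' ≤ g) (h0 : g 0 = 0) :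
    ∑ x, p x * excessGap θ ε (excessStep x g) (excessStep x g') ≤
      (1 + p 0 * (θ⁻¹ - 1) + q * (θ - 1) + θ * (m + 1) * ε) * excessGap θ ε g g' := by
  have hθ0 : 0 < θ := by linarith
  set D : Fin (m + 1) → ℝ := fun j => θ ^ g j - θ ^ g' j with hD
  have hDnn (i) : 0 ≤ D i := sub_nonneg.2 (pow_le_pow_right₀ hθ (h i))
  have hD0 : D 0 = 0 := by simp [hD, h0, Nat.le_zero.1 ((h 0).trans h0.le)]
  have hp1 (i) : p i ≤ 1 :=
    hsum ▸ Finset.single_le_sum (fun i _ => (hp i).le) (Finset.mem_univ i)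
  have coord (j) : ∑ x, p x * (θ ^ excessStep x g j - θ ^ excessStep x g' j) ≤
      (1 + p 0 * (θ⁻¹ - 1) + q * (θ - 1)) * D j + θ * ∑ x, if x < j then D x else 0 := by
    calc ∑ x, p x * (θ ^ excessStep x g j - θ ^ excessStep x g' j)
        ≤ ∑ x, (p x * D j + (if x = 0 then p x * ((θ⁻¹ - 1) * D j) else 0) +
            (if x = j then p x * ((θ - 1) * D j) else 0) +
            θ * (if x < j then D x else 0)) := by
          refine Finset.sum_le_sum fun x _ => ?_
          refine (mul_le_mul_of_nonneg_left (pow_excessStep_sub_le hθ h h0 x j)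
            (hp x).le).trans ?_
          have hlast : p x * (θ * (if x < j then D x else 0)) ≤
              θ * (if x < j then D x else 0) :=
            mul_le_of_le_one_left
              (mul_nonneg hθ0.le (by split_ifs; exacts [hDnn x, le_rfl])) (hp1 x)
          simp only [mul_add, mul_ite, mul_zero] at hlast ⊢
          linarith
      _ = (1 + p 0 * (θ⁻¹ - 1) + p j * (θ - 1)) * D j +
            θ * ∑ x, if x < j then D x else 0 := by
          simp only [Finset.sum_add_distrib, ← Finset.sum_mul, hsum, Finset.sum_ite_eq',
            Finset.mem_univ, if_true, ← Finset.mul_sum]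
          ring
      _ ≤ _ := by
          by_cases hj : j = 0
          · simp [hj, hD0]
          · have := mul_le_mul_of_nonneg_right (hq j hj)
              (mul_nonneg (sub_nonneg.2 hθ) (hDnn j))
            linarith
  have tail : ∑ j : Fin (m + 1), ε ^ (j : ℕ) * ∑ x, (if x < j then D x else 0) ≤
      (m + 1) * ε * ∑ x : Fin (m + 1), ε ^ (x : ℕ) * D x := by
    calc ∑ j : Fin (m + 1), ε ^ (j : ℕ) * ∑ x, (if x < j then D x else 0)
        ≤ ∑ _j : Fin (m + 1), ∑ x : Fin (m + 1), ε * (ε ^ (x : ℕ) * D x) := by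
          refine Finset.sum_le_sum fun j _ => ?_
          rw [Finset.mul_sum]
          refine Finset.sum_le_sum fun x _ => ?_
          split_ifs with hxj
          · rw [← mul_assoc, ← pow_succ']
            exact mul_le_mul_of_nonneg_right (pow_le_pow_of_le_one hε hε1 hxj) (hDnn x)
          · rw [mul_zero]
            exact mul_nonneg hε (mul_nonneg (pow_nonneg hε _) (hDnn x))
      _ = _ := by
          simp [← Finset.mul_sum]
          ring
  calc ∑ x, p x * excessGap θ ε (excessStep x g) (excessStep x g')
      = ∑ j : Fin (m + 1), ε ^ (j : ℕ) *
          ∑ x, p x * (θ ^ excessStep x g j - θ ^ excessStep x g' j) := by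
        simp only [excessGap, Finset.mul_sum]
        rw [Finset.sum_comm]
        exact Finset.sum_congr rfl fun _ _ => Finset.sum_congr rfl fun _ _ => by ring
    _ ≤ ∑ j : Fin (m + 1), ε ^ (j : ℕ) * ((1 + p 0 * (θ⁻¹ - 1) + q * (θ - 1)) * D j +
          θ * ∑ x, if x < j then D x else 0) :=
        Finset.sum_le_sum fun j _ => mul_le_mul_of_nonneg_left (coord j) (pow_nonneg hε _)
    _ = (1 + p 0 * (θ⁻¹ - 1) + q * (θ - 1)) * (∑ j : Fin (m + 1), ε ^ (j : ℕ) * D j) +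
          θ * ∑ j : Fin (m + 1), ε ^ (j : ℕ) * ∑ x, (if x < j then D x else 0) := by
        rw [Finset.mul_sum, Finset.mul_sum, ← Finset.sum_add_distrib]
        exact Finset.sum_congr rfl fun _ _ => by ring
    _ ≤ _ := by
        have := mul_le_mul_of_nonneg_left tail hθ0.le
        simp only [excessGap]
        linarith

lemma wordAvg_excessGap_le {m N : ℕ} {p : Fin (m + 1) → ℝ} (hp : ∀ i, 0 < p i)
    {θ ε ρ : ℝ} (hρ : 0 ≤ ρ)
    (hstep : ∀ g g' : Fin (m + 1) → ℕ, g' ≤ g → g 0 = 0 →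
      ∑ x, p x * excessGap θ ε (excessStep x g) (excessStep x g') ≤ ρ * excessGap θ ε g g')
    {g g' : Fin (m + 1) → ℕ} (h : g' ≤ g) (h0 : g 0 = 0) :
    wordAvg p (fun w : Fin N → Fin (m + 1) =>
      excessGap θ ε (excessRun g w) (excessRun g' w)) ≤ ρ ^ N * excessGap θ ε g g' := by
  induction N with
  | zero => simp [wordAvg_zero, excessRun]
  | succ N ih =>
    rw [wordAvg_succ]
    simp only [excessRun_snoc]
    refine (wordAvg_mono hp fun w =>
      hstep _ _ (excessRun_mono w h) (excessRun_zero w h0)).trans ?_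
    rw [wordAvg_const_mul, pow_succ', mul_assoc]
    exact mul_le_mul_of_nonneg_left ih hρ

lemma sub_mul_le_pow_sub_pow {θ : ℝ} (hθ : 1 ≤ θ) {a b : ℕ} (h : b ≤ a) :
    ((a : ℝ) - b) * (θ - 1) ≤ θ ^ a - θ ^ b := by
  obtain ⟨c, rfl⟩ := Nat.exists_eq_add_of_le h
  have h₁ : 1 + (c : ℝ) * (θ - 1) ≤ θ ^ c := by
    simpa using one_add_mul_le_pow (a := θ - 1) (by linarith) c
  have h₂ : 1 ≤ θ ^ b := one_le_pow₀ hθ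
  have h₃ : 0 ≤ (c : ℝ) * (θ - 1) := mul_nonneg c.cast_nonneg (by linarith)
  rw [pow_add]
  push_cast
  nlinarith

/-- The mean final excess forgets its initial state exponentially fast. -/
lemma exists_excess_coupling {m : ℕ} {p : Fin (m + 1) → ℝ} (hp : ∀ i, 0 < p i)
    (hsum : ∑ i, p i = 1) {q : ℝ} (hq0 : 0 < q) (hq : ∀ j, j ≠ 0 → p j ≤ q)
    (hqp : q < p 0) :
    ∃ θ ρ K : ℝ, 1 < θ ∧ θ * q < p 0 ∧ 0 ≤ ρ ∧ ρ < 1 ∧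
      ∀ (N : ℕ) (g : Fin (m + 1) → ℕ), g 0 = 0 → (∀ j, g j ≤ g (Fin.last m)) →
        wordAvg p (fun w : Fin N → Fin (m + 1) => (excessRun g w (Fin.last m) : ℝ)) ≤
          wordAvg p (fun w : Fin N → Fin (m + 1) => (excessRun 0 w (Fin.last m) : ℝ)) +
            K * ρ ^ N * θ ^ g (Fin.last m) := by
  obtain ⟨θ, hθ, hθq⟩ := exists_between ((one_lt_div hq0).2 hqp)
  rw [lt_div_iff₀ hq0] at hθq
  have hθ0 : 0 < θ := by linarith
  have hp01 : p 0 ≤ 1 :=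
    hsum ▸ Finset.single_le_sum (fun i _ => (hp i).le) (Finset.mem_univ 0)
  have hm : (0 : ℝ) < m + 1 := by positivity
  set d : ℝ := 1 + p 0 * (θ⁻¹ - 1) + q * (θ - 1) with hd
  have hd1 : d < 1 := by
    have : d = 1 - (θ - 1) * (p 0 - θ * q) * θ⁻¹ := by rw [hd]; field_simp; ring
    rw [this]
    have : 0 < (θ - 1) * (p 0 - θ * q) * θ⁻¹ :=
      mul_pos (mul_pos (by linarith) (by linarith)) (inv_pos.2 hθ0)
    linarith
  have hd0 : 0 ≤ d := by
    have h₁ : 0 ≤ p 0 * θ⁻¹ := mul_nonneg (hp 0).le (inv_pos.2 hθ0).le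
    have h₂ : 0 ≤ q * (θ - 1) := mul_nonneg hq0.le (by linarith)
    rw [hd]; linarith
  set ε : ℝ := (1 - d) / (2 * θ * (m + 1)) with hε
  have hden : 0 < 2 * θ * (m + 1 : ℝ) := by positivity
  have hε0 : 0 < ε := div_pos (by linarith) hden
  have hε1 : ε ≤ 1 := by
    rw [hε, div_le_one hden]
    have : (0 : ℝ) ≤ m := m.cast_nonneg
    nlinarith
  have hρ : d + θ * (m + 1) * ε = (1 + d) / 2 := by
    rw [hε]; field_simp; ring
  refine ⟨θ, (1 + d) / 2, (m + 1) / (ε ^ m * (θ - 1)), hθ, hθq, by linarith, by linarith,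
    fun N g h0 hg => ?_⟩
  have hc : 0 < ε ^ m * (θ - 1) := mul_pos (pow_pos hε0 m) (by linarith)
  have hgap := wordAvg_excessGap_le (N := N) hp (θ := θ) (ε := ε) (ρ := (1 + d) / 2)
    (by linarith) (fun g g' h h0 => by
      rw [← hρ]
      exact sum_excessGap_step_le hp hsum hθ.le hε0.le hε1 hq h h0)
    (g := g) (g' := 0) (fun _ => Nat.zero_le _) h0
  have hinit : excessGap θ ε g 0 ≤ (m + 1) * θ ^ g (Fin.last m) := by
    calc excessGap θ ε g 0 ≤ ∑ _j : Fin (m + 1), θ ^ g (Fin.last m) := by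
          refine Finset.sum_le_sum fun j _ => ?_
          have h₁ : (1 : ℝ) ≤ θ ^ g j := one_le_pow₀ hθ.le
          have h₂ : θ ^ g j ≤ θ ^ g (Fin.last m) := pow_le_pow_right₀ hθ.le (hg j)
          have h₃ : ε ^ (j : ℕ) ≤ 1 := pow_le_one₀ hε0.le hε1
          simp only [Pi.zero_apply, pow_zero]
          nlinarith
      _ = _ := by simp
  have hpt (w : Fin N → Fin (m + 1)) : (excessRun g w (Fin.last m) : ℝ) ≤
      excessRun 0 w (Fin.last m) +
        (ε ^ m * (θ - 1))⁻¹ * excessGap θ ε (excessRun g w) (excessRun 0 w) := by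
    have hle : excessRun 0 w ≤ excessRun g w := excessRun_mono w fun _ => Nat.zero_le _
    have h₁ := mul_le_mul_of_nonneg_left
      (sub_mul_le_pow_sub_pow hθ.le (hle (Fin.last m))) (pow_pos hε0 m).le
    have h₂ : ε ^ m * (θ ^ excessRun g w (Fin.last m) - θ ^ excessRun 0 w (Fin.last m)) ≤
        excessGap θ ε (excessRun g w) (excessRun 0 w) :=
      Finset.single_le_sum (f := fun j : Fin (m + 1) =>
          ε ^ (j : ℕ) * (θ ^ excessRun g w j - θ ^ excessRun 0 w j))
        (fun j _ => mul_nonneg (pow_pos hε0 _).le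
          (sub_nonneg.2 (pow_le_pow_right₀ hθ.le (hle j)))) (Finset.mem_univ (Fin.last m))
    rw [← sub_le_iff_le_add', inv_mul_eq_div, le_div_iff₀ hc]
    linarith
  refine (wordAvg_mono hp hpt).trans ?_
  rw [wordAvg_add, wordAvg_const_mul]
  refine add_le_add le_rfl ?_
  calc (ε ^ m * (θ - 1))⁻¹ * wordAvg p (fun w : Fin N → Fin (m + 1) =>
        excessGap θ ε (excessRun g w) (excessRun 0 w))
      ≤ (ε ^ m * (θ - 1))⁻¹ * (((1 + d) / 2) ^ N * ((m + 1) * θ ^ g (Fin.last m))) :=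
        mul_le_mul_of_nonneg_left (hgap.trans (mul_le_mul_of_nonneg_left hinit
          (pow_nonneg (by linarith) _))) (inv_pos.2 hc).le
    _ = _ := by ring

/-- The excess vector with increments `a`. -/
def partialSum {m : ℕ} (a : Fin m → ℕ) (j : Fin (m + 1)) : ℕ :=
  ∑ i : Fin m, if i.succ ≤ j then a i else 0

lemma partialSum_zero {m : ℕ} (a : Fin m → ℕ) : partialSum a 0 = 0 := by
  simp [partialSum, Fin.succ_ne_zero]

lemma partialSum_last {m : ℕ} (a : Fin m → ℕ) : partialSum a (Fin.last m) = ∑ i, a i := by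
  simp [partialSum, Fin.le_last]

lemma partialSum_mono {m : ℕ} (a : Fin m → ℕ) : Monotone (partialSum a) := by
  intro j j' h
  refine Finset.sum_le_sum fun i _ => ?_
  split_ifs with h₁ h₂
  · exact le_rfl
  · exact absurd (h₁.trans h) h₂
  · exact Nat.zero_le _
  · exact le_rfl

lemma partialSum_injective {m : ℕ} : Function.Injective (partialSum (m := m)) := by
  have key (a : Fin m → ℕ) (i : Fin m) :
      partialSum a i.succ = partialSum a i.castSucc + a i := by
    have : a i = ∑ i', if i' = i then a i' else 0 := by simp
    rw [this]
    unfold partialSum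
    rw [← Finset.sum_add_distrib]
    refine Finset.sum_congr rfl fun i' _ => ?_
    simp only [Fin.le_def, Fin.ext_iff, Fin.val_succ, Fin.val_castSucc]
    split_ifs <;> omega
  intro a b h
  ext i
  have := key a i
  rw [h, key b i] at this
  omega

lemma partialSum_indicator {m : ℕ} (x j : Fin (m + 1)) :
    partialSum (fun i => if i.succ = x then 1 else 0) j = if x ≠ 0 ∧ x ≤ j then 1 else 0 := by
  unfold partialSum
  induction x using Fin.cases with
  | zero => simp [Fin.succ_ne_zero]
  | succ x =>
    rw [Finset.sum_eq_single x]
    · simp [Fin.succ_ne_zero]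
    · intro i _ hi
      simp [hi]
    · simp

lemma partialSum_add {m : ℕ} (a b : Fin m → ℕ) (j : Fin (m + 1)) :
    partialSum (fun i => a i + b i) j = partialSum a j + partialSum b j := by
  unfold partialSum
  rw [← Finset.sum_add_distrib]
  exact Finset.sum_congr rfl fun i _ => by split_ifs <;> rfl

/-- Reversal of the insertion dynamics: every state `a'` together with an expelled letter `y`
arises by reading a letter `x` in a state `a`. -/
lemma exists_reverse_step {m : ℕ} (a' : Fin m → ℕ) (y : Fin (m + 1)) :
    ∃ (a : Fin m → ℕ) (x : Fin (m + 1)),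
      (∀ i, a i + (if i.succ = x then 1 else 0) = a' i + if i.succ = y then 1 else 0) ∧
      excessStep x (partialSum a) = partialSum a' := by
  obtain ⟨x, hxy, hx, hmax⟩ : ∃ x : Fin (m + 1), (y = 0 ∨ x < y) ∧
      (∀ i : Fin m, i.succ = x → a' i ≠ 0) ∧
      ∀ i : Fin m, x < i.succ → (y = 0 ∨ i.succ < y) → a' i = 0 := by
    set S : Finset (Fin (m + 1)) := Finset.univ.filter fun j =>
      (y = 0 ∨ j < y) ∧ ∀ i : Fin m, i.succ = j → a' i ≠ 0 with hS
    have h0 : (0 : Fin (m + 1)) ∈ S := by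
      simp only [hS, Finset.mem_filter, Finset.mem_univ, true_and]
      exact ⟨(eq_or_ne y 0).imp id Fin.pos_iff_ne_zero.2,
        fun i hi => absurd hi (Fin.succ_ne_zero i)⟩
    have hm := S.max'_mem ⟨0, h0⟩
    simp only [hS, Finset.mem_filter, Finset.mem_univ, true_and] at hm
    refine ⟨S.max' ⟨0, h0⟩, hm.1, hm.2, fun i hi hiy => ?_⟩
    by_contra hne
    refine absurd (S.le_max' i.succ ?_) (not_le.2 hi)
    simp only [hS, Finset.mem_filter, Finset.mem_univ, true_and]
    exact ⟨hiy, fun i' hi' => by rwa [Fin.succ_injective _ hi']⟩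
  set a : Fin m → ℕ := fun i =>
    a' i - (if i.succ = x then 1 else 0) + if i.succ = y then 1 else 0 with ha
  have hrel (i) : a i + (if i.succ = x then 1 else 0) = a' i + if i.succ = y then 1 else 0 := by
    simp only [ha]
    by_cases h : i.succ = x
    · have := hx i h
      rw [if_pos h]
      omega
    · rw [if_neg h]
      omega
  refine ⟨a, x, hrel, ?_⟩
  have hsumrel (j) : partialSum a j + (if x ≠ 0 ∧ x ≤ j then 1 else 0) =
      partialSum a' j + if y ≠ 0 ∧ y ≤ j then 1 else 0 := by
    rw [← partialSum_indicator, ← partialSum_indicator, ← partialSum_add, ← partialSum_add]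
    simp only [hrel]
  have hconst (j) (hj : x ≤ j) (hjy : y = 0 ∨ j < y) : partialSum a' j = partialSum a' x := by
    refine Finset.sum_congr rfl fun i _ => ?_
    split_ifs with h₁ h₂ h₂
    · rfl
    · exact hmax i (not_le.1 h₂) (hjy.imp id h₁.trans_lt)
    · exact absurd (h₂.trans hj) h₁
    · rfl
  ext j
  have hj := hsumrel j
  have hxx := hsumrel x
  have hz := partialSum_zero a'
  unfold excessStep
  by_cases hx0 : x = 0
  · subst hx0
    by_cases hjy : y = 0 ∨ j < y
    · have := hconst j (Fin.zero_le _) hjy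
      have hn : ¬ (y ≠ 0 ∧ y ≤ j) := by rintro ⟨h₁, h₂⟩; exact hjy.elim h₁ h₂.not_gt
      simp only [hn, if_false, ne_eq, not_true_eq_false, false_and, if_true] at hj ⊢
      omega
    · push Not at hjy
      simp only [ne_eq, hjy, not_false_eq_true, and_self, if_true, not_true_eq_false,
        false_and, if_false] at hj ⊢
      omega
  · have hyx : ¬ (y ≠ 0 ∧ y ≤ x) := by rintro ⟨h₁, h₂⟩; exact hxy.elim h₁ h₂.not_gt
    simp only [hyx, hx0, if_false, ne_eq, not_false_eq_true, le_refl, and_self, if_true,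
      true_and] at hj hxx ⊢
    by_cases hxj : x ≤ j
    · have hmono := partialSum_mono a' hxj
      by_cases hjy : y = 0 ∨ j < y
      · have := hconst j hxj hjy
        have hn : ¬ (¬ y = 0 ∧ y ≤ j) := by rintro ⟨h₁, h₂⟩; exact hjy.elim h₁ h₂.not_gt
        simp only [hn, hxj, if_true, if_false] at hj ⊢
        omega
      · push Not at hjy
        have hn : ¬ y = 0 ∧ y ≤ j := hjy
        rw [if_pos hn] at hj
        simp only [hxj, if_true] at hj ⊢
        omega
    · have hn : ¬ (¬ y = 0 ∧ y ≤ j) := by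
        rintro ⟨h₁, h₂⟩
        rcases hxy with h | h
        · exact h₁ h
        · exact hxj (h.le.trans h₂)
      simp only [hn, hxj, if_false] at hj ⊢
      omega

/-- The geometric distribution on `ℕ` with ratio `r`. -/
def ratioGeometric (r : unitInterval) : Measure ℕ :=
  ProbabilityTheory.geometricMeasure (unitInterval.symm r)

instance (r : unitInterval) : IsProbabilityMeasure (ratioGeometric r) :=
  inferInstanceAs (IsProbabilityMeasure (ProbabilityTheory.geometricMeasure _))

lemma unitInterval_symm_ne_zero {r : unitInterval} (hr : (r : ℝ) < 1) :
    unitInterval.symm r ≠ 0 := by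
  intro h
  have := congrArg Subtype.val h
  simp only [unitInterval.coe_symm_eq, Set.Icc.coe_zero] at this
  linarith

lemma ratioGeometric_singleton {r : unitInterval} (hr : (r : ℝ) < 1) (n : ℕ) :
    ratioGeometric r {n} = ENNReal.ofReal ((r : ℝ) ^ n * (1 - r)) := by
  rw [ratioGeometric,
    ProbabilityTheory.geometricMeasure_singleton (unitInterval_symm_ne_zero hr)]
  simp

lemma integrable_ratioGeometric_pow {r : unitInterval} {θ : ℝ} (hθ : 1 ≤ θ)
    (hr : θ * r < 1) : Integrable (fun n : ℕ => θ ^ n) (ratioGeometric r) := by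
  have h0 : 0 ≤ (r : ℝ) := r.2.1
  have hr1 : (r : ℝ) < 1 := by nlinarith
  rw [ratioGeometric,
    ProbabilityTheory.integrable_geometricMeasure_iff (unitInterval_symm_ne_zero hr1)]
  have hs : Summable fun n : ℕ => (1 - (r : ℝ)) * (θ * r) ^ n :=
    (summable_geometric_of_lt_one (by positivity) hr).mul_left _
  refine hs.congr fun n => ?_
  rw [Real.norm_of_nonneg (by positivity)]
  simp [mul_pow]
  ring

lemma integrable_ratioGeometric_id {r : unitInterval} (hr : (r : ℝ) < 1) :
    Integrable (fun n : ℕ => (n : ℝ)) (ratioGeometric r) := by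
  have h0 : 0 ≤ (r : ℝ) := r.2.1
  rw [ratioGeometric,
    ProbabilityTheory.integrable_geometricMeasure_iff (unitInterval_symm_ne_zero hr)]
  have hs := (hasSum_coe_mul_geometric_of_norm_lt_one
    (by rwa [Real.norm_of_nonneg h0] : ‖(r : ℝ)‖ < 1)).summable.mul_left (1 - (r : ℝ))
  refine hs.congr fun n => ?_
  simp
  ring

lemma integral_ratioGeometric_id {r : unitInterval} (hr : (r : ℝ) < 1) :
    ∫ n : ℕ, (n : ℝ) ∂ratioGeometric r = r / (1 - r) := by
  have h0 : 0 ≤ (r : ℝ) := r.2.1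
  rw [ratioGeometric,
    ProbabilityTheory.integral_geometricMeasure (unitInterval_symm_ne_zero hr)]
  have hs := (hasSum_coe_mul_geometric_of_norm_lt_one
    (by rwa [Real.norm_of_nonneg h0] : ‖(r : ℝ)‖ < 1)).mul_left (1 - (r : ℝ))
  have h1 : 1 - (r : ℝ) ≠ 0 := by linarith
  calc _ = ∑' n : ℕ, (1 - (r : ℝ)) * (n * (r : ℝ) ^ n) :=
        tsum_congr fun n => by simp; ring
    _ = (1 - (r : ℝ)) * (r / (1 - r) ^ 2) := hs.tsum_eq
    _ = _ := by field_simp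

/-- The stationary law of the increments of the excess vector. -/
def stationaryLaw {m : ℕ} (r : Fin m → unitInterval) : Measure (Fin m → ℕ) :=
  Measure.pi fun i => ratioGeometric (r i)

instance {m : ℕ} (r : Fin m → unitInterval) : IsProbabilityMeasure (stationaryLaw r) :=
  inferInstanceAs (IsProbabilityMeasure (Measure.pi _))

section Stationary

variable {m : ℕ} {p : Fin (m + 1) → ℝ} {r : Fin m → unitInterval}

lemma stationaryLaw_singleton_mul (hp : ∀ i, 0 < p i) (hr : ∀ i, (r i : ℝ) = p i.succ / p 0)
    (hr1 : ∀ i, (r i : ℝ) < 1) {a a' : Fin m → ℕ} {x y : Fin (m + 1)}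
    (h : ∀ i, a i + (if i.succ = x then 1 else 0) = a' i + if i.succ = y then 1 else 0) :
    ENNReal.ofReal (p x) * stationaryLaw r {a} = ENNReal.ofReal (p y) * stationaryLaw r {a'} := by
  have hsingle (b : Fin m → ℕ) : stationaryLaw r {b} =
      ENNReal.ofReal (∏ i, ((r i : ℝ) ^ b i * (1 - r i))) := by
    rw [stationaryLaw, Measure.pi_singleton, ENNReal.ofReal_prod_of_nonneg fun i _ =>
      mul_nonneg (pow_nonneg (r i).2.1 _) (sub_nonneg.2 (r i).2.2)]
    exact Finset.prod_congr rfl fun i _ => ratioGeometric_singleton (hr1 i) _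
  have hind (z : Fin (m + 1)) :
      p z = p 0 * ∏ i, (r i : ℝ) ^ (if i.succ = z then 1 else 0) := by
    induction z using Fin.cases with
    | zero => simp [Fin.succ_ne_zero]
    | succ z =>
      rw [Finset.prod_eq_single z (fun i _ hi => by simp [hi]) (by simp)]
      rw [if_pos rfl, pow_one, hr, mul_div_cancel₀ _ (hp 0).ne']
  rw [hsingle, hsingle, ← ENNReal.ofReal_mul (hp x).le, ← ENNReal.ofReal_mul (hp y).le,
    hind x, hind y, mul_assoc, mul_assoc, ← Finset.prod_mul_distrib, ← Finset.prod_mul_distrib]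
  congr 2
  refine Finset.prod_congr rfl fun i _ => ?_
  rw [← mul_assoc, ← mul_assoc, ← pow_add, ← pow_add, add_comm, h i, add_comm]

/-- The law of `partialSum` under `stationaryLaw` is invariant under reading a random letter. -/
lemma map_partialSum_stationary (hp : ∀ i, 0 < p i) (hsum : ∑ i, p i = 1)
    (hr : ∀ i, (r i : ℝ) = p i.succ / p 0) (hr1 : ∀ i, (r i : ℝ) < 1) :
    (stationaryLaw r).map partialSum =
      ∑ x, ENNReal.ofReal (p x) •
        ((stationaryLaw r).map partialSum).map (excessStep x) := by
  have hps : Measurable (partialSum (m := m)) := Measurable.of_discrete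
  have hst (x : Fin (m + 1)) : Measurable (excessStep x) := Measurable.of_discrete
  set μ := (stationaryLaw r).map partialSum with hμ
  set ν := ∑ x, ENNReal.ofReal (p x) • μ.map (excessStep x) with hν
  have hμp : IsProbabilityMeasure μ := Measure.isProbabilityMeasure_map hps.aemeasurable
  have hνp : IsProbabilityMeasure ν := by
    constructor
    simp only [hν, Measure.finsetSum_apply, Measure.smul_apply, smul_eq_mul,
      Measure.map_apply (hst _) MeasurableSet.univ, Set.preimage_univ, measure_univ, mul_one]
    rw [← ENNReal.ofReal_sum_of_nonneg fun i _ => (hp i).le, hsum, ENNReal.ofReal_one]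
  suffices h : ∀ g, μ {g} ≤ ν {g} by
    refine Measure.eq_of_le_of_isProbabilityMeasure (Measure.le_iff.2 fun s hs => ?_)
    rw [← μ.tsum_indicator_apply_singleton s hs, ← ν.tsum_indicator_apply_singleton s hs]
    exact ENNReal.tsum_le_tsum fun g => Set.indicator_le_indicator (h g)
  intro g
  by_cases hg : ∃ a', partialSum a' = g
  swap
  · have : partialSum ⁻¹' {g} = (∅ : Set (Fin m → ℕ)) :=
      Set.eq_empty_of_forall_notMem fun a ha => hg ⟨a, ha⟩
    rw [hμ, Measure.map_apply hps (measurableSet_singleton g), this]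
    simp
  obtain ⟨a', rfl⟩ := hg
  choose A X hrel hstep using exists_reverse_step a'
  have hinj (x : Fin (m + 1)) :
      Set.InjOn A (Finset.univ.filter fun y => X y = x : Finset (Fin (m + 1))) := by
    intro y hy z hz hyz
    simp only [Finset.coe_filter, Finset.mem_univ, true_and, Set.mem_ofPred_eq] at hy hz
    have key (i : Fin m) : i.succ = y ↔ i.succ = z := by
      have h₁ := hrel y i
      have h₂ := hrel z i
      rw [hyz, hy] at h₁
      rw [hz, h₁] at h₂
      by_cases hiy : i.succ = y <;> by_cases hiz : i.succ = z <;> simp_all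
    induction y using Fin.cases with
    | zero =>
      induction z using Fin.cases with
      | zero => rfl
      | succ z => exact (key z).2 rfl |>.symm
    | succ y => exact (key y).1 rfl
  calc μ {partialSum a'} = stationaryLaw r {a'} := by
        rw [hμ, Measure.map_apply hps (measurableSet_singleton _)]
        congr 1
        ext b
        simpa using partialSum_injective.eq_iff
    _ = ∑ y, ENNReal.ofReal (p y) * stationaryLaw r {a'} := by
        rw [← Finset.sum_mul, ← ENNReal.ofReal_sum_of_nonneg fun i _ => (hp i).le, hsum,
          ENNReal.ofReal_one, one_mul]
    _ = ∑ y, ENNReal.ofReal (p (X y)) * stationaryLaw r {A y} :=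
        Finset.sum_congr rfl fun y _ =>
          (stationaryLaw_singleton_mul hp hr hr1 (hrel y)).symm
    _ = ∑ x, ∑ y with X y = x, ENNReal.ofReal (p (X y)) * stationaryLaw r {A y} :=
        (Finset.sum_fiberwise _ _ _).symm
    _ ≤ ∑ x, ENNReal.ofReal (p x) * μ.map (excessStep x) {partialSum a'} := by
        refine Finset.sum_le_sum fun x _ => ?_
        calc ∑ y with X y = x, ENNReal.ofReal (p (X y)) * stationaryLaw r {A y}
            = ENNReal.ofReal (p x) * ∑ y with X y = x, stationaryLaw r {A y} := by
              rw [Finset.mul_sum]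
              refine Finset.sum_congr rfl fun y hy => ?_
              rw [(Finset.mem_filter.1 hy).2]
          _ = ENNReal.ofReal (p x) * stationaryLaw r
                ((Finset.univ.filter fun y => X y = x).image A : Finset (Fin m → ℕ)) := by
              rw [← sum_measure_singleton, Finset.sum_image (hinj x)]
          _ ≤ _ := by
              rw [Measure.map_apply (hst x) (measurableSet_singleton _), hμ,
                Measure.map_apply hps (hst x (measurableSet_singleton _))]
              gcongr
              intro b hb
              obtain ⟨y, hy, rfl⟩ := Finset.mem_image.1 (Finset.mem_coe.1 hb)
              rw [← (Finset.mem_filter.1 hy).2]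
              exact hstep y
    _ = ν {partialSum a'} := by
        simp [hν, Measure.finsetSum_apply]

lemma integral_step_of_stationary {μ : Measure (Fin (m + 1) → ℕ)} (hp : ∀ i, 0 < p i)
    (hμ : μ = ∑ x, ENNReal.ofReal (p x) • μ.map (excessStep x))
    {G : (Fin (m + 1) → ℕ) → ℝ} (hG : Integrable G μ) :
    Integrable (fun g => ∑ x, p x * G (excessStep x g)) μ ∧
      ∫ g, ∑ x, p x * G (excessStep x g) ∂μ = ∫ g, G g ∂μ := by
  have hst (x : Fin (m + 1)) : AEMeasurable (excessStep x) μ :=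
    Measurable.of_discrete.aemeasurable
  have hsm {κ : Measure (Fin (m + 1) → ℕ)} : AEStronglyMeasurable G κ :=
    (Measurable.of_discrete (f := G)).aestronglyMeasurable
  have h₁ : ∀ x ∈ Finset.univ, Integrable G (ENNReal.ofReal (p x) • μ.map (excessStep x)) := by
    rw [← integrable_finsetSum_measure, ← hμ]
    exact hG
  have h₂ (x : Fin (m + 1)) : Integrable (fun g => G (excessStep x g)) μ := by
    have := h₁ x (Finset.mem_univ x)
    rw [integrable_smul_measure (by simpa using hp x) ENNReal.ofReal_ne_top,
      integrable_map_measure hsm (hst x)] at this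
    exact this
  refine ⟨integrable_finsetSum _ fun x _ => (h₂ x).const_mul _, ?_⟩
  rw [integral_finsetSum _ fun x _ => (h₂ x).const_mul _]
  conv_rhs => rw [hμ, integral_finsetSum_measure h₁]
  refine Finset.sum_congr rfl fun x _ => ?_
  rw [integral_const_mul, integral_smul_measure, ENNReal.toReal_ofReal (hp x).le,
    integral_map (hst x) hsm, smul_eq_mul]

lemma integral_wordAvg_of_stationary {μ : Measure (Fin (m + 1) → ℕ)} (hp : ∀ i, 0 < p i)
    (hμ : μ = ∑ x, ENNReal.ofReal (p x) • μ.map (excessStep x)) (N : ℕ)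
    {G : (Fin (m + 1) → ℕ) → ℝ} (hG : Integrable G μ) :
    Integrable (fun g => wordAvg p fun w : Fin N → Fin (m + 1) => G (excessRun g w)) μ ∧
      ∫ g, (wordAvg p fun w : Fin N → Fin (m + 1) => G (excessRun g w)) ∂μ = ∫ g, G g ∂μ := by
  induction N generalizing G with
  | zero => simpa [wordAvg_zero, excessRun] using hG
  | succ N ih =>
    obtain ⟨h₁, h₂⟩ := integral_step_of_stationary hp hμ hG
    simp only [wordAvg_succ, excessRun_snoc]
    rw [← h₂]
    exact ih h₁

lemma integrable_partialSum_last (hr1 : ∀ i, (r i : ℝ) < 1) :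
    Integrable (fun a => (partialSum a (Fin.last m) : ℝ)) (stationaryLaw r) ∧
      ∫ a, (partialSum a (Fin.last m) : ℝ) ∂stationaryLaw r = ∑ i, (r i : ℝ) / (1 - r i) := by
  have hmp (i : Fin m) : MeasurePreserving (Function.eval i) (stationaryLaw r)
      (ratioGeometric (r i)) := measurePreserving_eval _ i
  have hint (i : Fin m) : Integrable (fun a : Fin m → ℕ => (a i : ℝ)) (stationaryLaw r) :=
    (hmp i).integrable_comp_of_integrable (integrable_ratioGeometric_id (hr1 i))
  simp only [partialSum_last, Nat.cast_sum]
  refine ⟨integrable_finsetSum _ fun i _ => hint i, ?_⟩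
  rw [integral_finsetSum _ fun i _ => hint i]
  refine Finset.sum_congr rfl fun i _ => ?_
  rw [← integral_ratioGeometric_id (hr1 i), ← (hmp i).map_eq,
    integral_map (hmp i).measurable.aemeasurable
      (Measurable.of_discrete.aestronglyMeasurable)]

lemma integrable_pow_partialSum_last {θ : ℝ} (hθ : 1 ≤ θ) (hr : ∀ i, θ * r i < 1) :
    Integrable (fun a => θ ^ partialSum a (Fin.last m)) (stationaryLaw r) := by
  simp only [partialSum_last, ← Finset.prod_pow_eq_pow_sum]
  exact Integrable.fintype_prod fun i => integrable_ratioGeometric_pow hθ (hr i)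

end Stationary

/-- The mean excess converges exponentially fast to its stationary value. -/
lemma exists_abs_wordAvg_excessRun_sub_le {m : ℕ} {p : Fin (m + 1) → ℝ} (hp : ∀ i, 0 < p i)
    (hsum : ∑ i, p i = 1) {q : ℝ} (hq0 : 0 < q) (hq : ∀ j, j ≠ 0 → p j ≤ q)
    (hqp : q < p 0) :
    ∃ ρ K : ℝ, 0 ≤ ρ ∧ ρ < 1 ∧ ∀ N : ℕ,
      |wordAvg p (fun w : Fin N → Fin (m + 1) => (excessRun 0 w (Fin.last m) : ℝ)) -
        ∑ i : Fin m, p i.succ / (p 0 - p i.succ)| ≤ K * ρ ^ N := by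
  obtain ⟨θ, ρ, K, hθ, hθq, hρ0, hρ1, hK⟩ := exists_excess_coupling hp hsum hq0 hq hqp
  have hlt (i : Fin m) : p i.succ < p 0 := (hq _ (Fin.succ_ne_zero i)).trans_lt hqp
  set r : Fin m → unitInterval := fun i => ⟨p i.succ / p 0, div_nonneg (hp _).le (hp 0).le,
    (div_le_one (hp 0)).2 (hlt i).le⟩
  have hr (i) : (r i : ℝ) = p i.succ / p 0 := rfl
  have hr1 (i) : (r i : ℝ) < 1 := (div_lt_one (hp 0)).2 (hlt i)
  have hθr (i) : θ * r i < 1 := by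
    rw [hr, ← mul_div_assoc, div_lt_one (hp 0)]
    exact (mul_le_mul_of_nonneg_left (hq _ (Fin.succ_ne_zero i)) (by linarith)).trans_lt hθq
  have hps : AEMeasurable (partialSum (m := m)) (stationaryLaw r) :=
    Measurable.of_discrete.aemeasurable
  have hsm {G : (Fin (m + 1) → ℕ) → ℝ} {κ : Measure (Fin (m + 1) → ℕ)} :
      AEStronglyMeasurable G κ := (Measurable.of_discrete (f := G)).aestronglyMeasurable
  obtain ⟨hlast, hmean⟩ := integrable_partialSum_last hr1
  have hpow := integrable_pow_partialSum_last hθ.le hθr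
  refine ⟨ρ, K * ∫ a, θ ^ partialSum a (Fin.last m) ∂stationaryLaw r, hρ0, hρ1, fun N => ?_⟩
  obtain ⟨hint, heq⟩ := integral_wordAvg_of_stationary hp
    (map_partialSum_stationary hp hsum hr hr1) N
    (G := fun g => (g (Fin.last m) : ℝ)) ((integrable_map_measure hsm hps).2 hlast)
  rw [integral_map hps hsm, integral_map hps hsm, hmean] at heq
  have hint' := (integrable_map_measure hsm hps).1 hint
  have hval : ∑ i, (r i : ℝ) / (1 - r i) = ∑ i : Fin m, p i.succ / (p 0 - p i.succ) := by
    refine Finset.sum_congr rfl fun i _ => ?_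
    have h₁ := (hp 0).ne'
    have h₂ : p 0 - p i.succ ≠ 0 := (sub_pos.2 (hlt i)).ne'
    rw [hr, one_sub_div h₁, div_div_div_cancel_right₀ h₁]
  rw [hval] at heq
  set M := wordAvg p (fun w : Fin N → Fin (m + 1) => (excessRun 0 w (Fin.last m) : ℝ))
  have lower : M ≤ ∑ i : Fin m, p i.succ / (p 0 - p i.succ) := by
    rw [← heq]
    calc M = ∫ _a, M ∂stationaryLaw r := by simp
      _ ≤ _ := integral_mono (integrable_const _) hint' fun a => wordAvg_mono hp fun w =>
        Nat.cast_le.2 (excessRun_mono w (fun _ => Nat.zero_le _) _)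
  have upper : ∑ i : Fin m, p i.succ / (p 0 - p i.succ) ≤
      M + K * ρ ^ N * ∫ a, θ ^ partialSum a (Fin.last m) ∂stationaryLaw r := by
    rw [← heq]
    calc _ ≤ ∫ a, (M + K * ρ ^ N * θ ^ partialSum a (Fin.last m)) ∂stationaryLaw r :=
          integral_mono hint' ((integrable_const _).add (hpow.const_mul _)) fun a =>
            hK N _ (partialSum_zero a) fun j => partialSum_mono a (Fin.le_last j)
      _ = _ := by
          rw [integral_add (integrable_const _) (hpow.const_mul _), integral_const_mul]
          simp
  rw [abs_sub_comm, abs_of_nonneg (by linarith)]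
  linarith

lemma exists_pow_le_div_sqrt {ρ : ℝ} (h0 : 0 ≤ ρ) (h1 : ρ < 1) :
    ∃ B : ℝ, ∀ N : ℕ, 1 ≤ N → ρ ^ N ≤ B / Real.sqrt N := by
  obtain ⟨B, hB⟩ := (tendsto_pow_const_mul_const_pow_of_abs_lt_one 1
    (by rwa [abs_of_nonneg h0] : |ρ| < 1)).bddAbove_range
  refine ⟨B, fun N hN => ?_⟩
  have hN1 : (1 : ℝ) ≤ N := by exact_mod_cast hN
  rw [le_div_iff₀ (Real.sqrt_pos.2 (by linarith))]
  have hB' : (N : ℝ) ^ 1 * ρ ^ N ≤ B := hB ⟨N, rfl⟩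
  have hs : Real.sqrt N ≤ N :=
    Real.sqrt_le_iff.2 ⟨by linarith, by nlinarith⟩
  calc ρ ^ N * Real.sqrt N ≤ ρ ^ N * N := mul_le_mul_of_nonneg_left hs (pow_nonneg h0 N)
    _ ≤ B := by rw [mul_comm]; simpa using hB'

/-- If all the probabilities are distinct, then
`E(ℓ_N) = Np₁ + Σ_{j≥2} p_j/(p₁-p_j) + O(N^{-1/2})`. -/
theorem random_words_mean_asymptotics
    (k : ℕ) (hk : 2 ≤ k) (p : Fin k → ℝ)
    (hp : ∀ i, 0 < p i ∧ p i < 1) (hsum : ∑ i, p i = 1)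
    (hdist : StrictAnti p) :
    ∃ C : ℝ, ∀ N : ℕ, 1 ≤ N →
      |wordMean k N p - N * p ⟨0, by omega⟩ -
          ∑ j ∈ Finset.univ \ {(⟨0, by omega⟩ : Fin k)},
            p j / (p ⟨0, by omega⟩ - p j)| ≤
        C / Real.sqrt N := by
  obtain ⟨m, rfl⟩ : ∃ m, k = m + 1 := ⟨k - 1, by omega⟩
  have hp' : ∀ i, 0 < p i := fun i => (hp i).1
  change ∃ C : ℝ, ∀ N : ℕ, 1 ≤ N →
    |wordMean (m + 1) N p - N * p 0 -
      ∑ j ∈ Finset.univ \ {(0 : Fin (m + 1))}, p j / (p 0 - p j)| ≤ C / Real.sqrt N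
  let one : Fin (m + 1) := ⟨1, by omega⟩
  have hq : ∀ j, j ≠ 0 → p j ≤ p one := fun j hj => hdist.antitone (by
    rw [Fin.le_def]
    exact Nat.one_le_iff_ne_zero.2 fun h => hj (Fin.ext h))
  have hqp : p one < p 0 := hdist (by rw [Fin.lt_def]; exact Nat.one_pos)
  obtain ⟨ρ, K, hρ0, hρ1, hK⟩ :=
    exists_abs_wordAvg_excessRun_sub_le hp' hsum (hp' one) hq hqp
  obtain ⟨B, hB⟩ := exists_pow_le_div_sqrt hρ0 hρ1
  have hlimit : ∑ j ∈ Finset.univ \ {(0 : Fin (m + 1))}, p j / (p 0 - p j) =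
      ∑ i : Fin m, p i.succ / (p 0 - p i.succ) := by
    have h := Finset.sum_sdiff (Finset.subset_univ {(0 : Fin (m + 1))})
      (f := fun j => p j / (p 0 - p j))
    rw [Fin.sum_univ_succ, Finset.sum_singleton] at h
    linarith
  refine ⟨|K| * B, fun N hN => ?_⟩
  rw [wordMean_eq hsum, hlimit, add_sub_cancel_left]
  calc _ ≤ K * ρ ^ N := hK N
    _ ≤ |K| * ρ ^ N := mul_le_mul_of_nonneg_right (le_abs_self K) (pow_nonneg hρ0 N)
    _ ≤ |K| * (B / Real.sqrt N) := mul_le_mul_of_nonneg_left (hB N hN) (abs_nonneg K)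
    _ = _ := by ring

end
end

section
/- There exists a homogeneous polynomial Q of degree three in k real variables such that for every fixed x ∈ ℝ^k, the characteristic function of the rescaled multinomial variables satisfies E_{M_p}[exp(i Σ_j x_j ξ_j)] = (1 + i Q(x)/√N) · exp(−½ Σ_j x_j² + ½ (Σ_j √(p_j) x_j)²) + O(1/N) as N → ∞, where ξ_j = (λ_j − N p_j)/√(N p_j) and λ ~ M_p with N trials. -/
open MeasureTheory Filter
open scoped Classical

noncomputable section

theorem norm_pow_sub_pow_le_mul {R : Type*} [NormedCommRing R] [NormOneClass R] {a b : R}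
    (ha : ‖a‖ ≤ 1) (hb : ‖b‖ ≤ 1) (n : ℕ) : ‖a ^ n - b ^ n‖ ≤ n * ‖a - b‖ := by
  induction n with
  | zero => simp
  | succ n ih =>
    have hsplit : a ^ (n + 1) - b ^ (n + 1) = a ^ n * (a - b) + (a ^ n - b ^ n) * b := by ring
    rw [hsplit]
    have h₁ : ‖a ^ n * (a - b)‖ ≤ ‖a - b‖ :=
      (norm_mul_le _ _).trans (mul_le_of_le_one_left (norm_nonneg _)
        ((norm_pow_le a n).trans (pow_le_one₀ (norm_nonneg _) ha)))
    have h₂ : ‖(a ^ n - b ^ n) * b‖ ≤ n * ‖a - b‖ :=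
      (norm_mul_le _ _).trans ((mul_le_of_le_one_right (norm_nonneg _) hb).trans ih)
    push_cast
    linarith [norm_add_le (a ^ n * (a - b)) ((a ^ n - b ^ n) * b)]

/-- Third-order expansion of the characteristic function of a finitely supported centered
distribution. -/
theorem norm_charFun_sub_cubic_le {ι : Type*} [Fintype ι] {p b : ι → ℝ} (hp : ∀ i, 0 ≤ p i)
    (hsum : ∑ i, p i = 1) (hmean : ∑ i, p i * b i = 0) {t : ℝ} (ht : |t| ≤ 1) :
    ‖(∑ i, (p i : ℂ) * Complex.exp (Complex.I * (t * b i : ℝ))) -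
        (1 - (∑ i, p i * b i ^ 2 : ℝ) * t ^ 2 / 2
          - Complex.I * (∑ i, p i * b i ^ 3 : ℝ) * t ^ 3 / 6)‖
      ≤ (∑ i, p i * (|b i| ^ 4 * Real.exp |b i|)) * t ^ 4 := by
  have hpoly : (1 - (∑ i, p i * b i ^ 2 : ℝ) * (t : ℂ) ^ 2 / 2
      - Complex.I * (∑ i, p i * b i ^ 3 : ℝ) * t ^ 3 / 6 : ℂ) =
      ∑ i, (p i : ℂ) * ∑ m ∈ Finset.range 4,
        (Complex.I * (t * b i : ℝ)) ^ m / (m.factorial : ℂ) := by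
    have h₀ : (∑ i, (p i : ℂ)) = 1 := mod_cast hsum
    have h₁ : (∑ i, (p i : ℂ) * b i) = 0 := mod_cast hmean
    have hterm : ∀ i, (p i : ℂ) * ∑ m ∈ Finset.range 4,
        (Complex.I * (t * b i : ℝ)) ^ m / (m.factorial : ℂ) =
        (p i : ℂ) + Complex.I * t * (p i * b i) - t ^ 2 / 2 * (p i * b i ^ 2)
          - Complex.I * t ^ 3 / 6 * (p i * b i ^ 3) := by
      intro i
      have h₃ : Complex.I ^ 3 = -Complex.I := Complex.I_pow_three
      simp only [Finset.sum_range_succ, Finset.sum_range_zero, Nat.factorial, mul_pow,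
        Complex.I_sq, h₃]
      push_cast
      ring
    simp only [hterm, Finset.sum_add_distrib, Finset.sum_sub_distrib, ← Finset.mul_sum, h₀, h₁]
    push_cast
    ring
  rw [hpoly, ← Finset.sum_sub_distrib, Finset.sum_mul]
  refine norm_sum_le_of_le _ fun i _ ↦ ?_
  rw [← mul_sub, norm_mul, Complex.norm_real, Real.norm_of_nonneg (hp i), mul_assoc]
  refine mul_le_mul_of_nonneg_left ?_ (hp i)
  have hnorm : ‖Complex.I * ((t * b i : ℝ) : ℂ)‖ = |t| * |b i| := by
    rw [norm_mul, Complex.norm_I, one_mul, Complex.norm_real, Real.norm_eq_abs, abs_mul]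
  have hexp : |t| * |b i| ≤ |b i| := mul_le_of_le_one_left (abs_nonneg _) ht
  calc _ ≤ ‖Complex.I * ((t * b i : ℝ) : ℂ)‖ ^ 4 *
          Real.exp ‖Complex.I * ((t * b i : ℝ) : ℂ)‖ := Complex.norm_exp_sub_sum_le_norm_mul_exp _ 4
    _ = |b i| ^ 4 * Real.exp (|t| * |b i|) * t ^ 4 := by
        rw [hnorm, mul_pow, (by decide : Even 4).pow_abs t]; ring
    _ ≤ _ := by gcongr

theorem norm_exp_sub_one_sub_le (z : ℂ) :
    ‖Complex.exp z - (1 + z)‖ ≤ ‖z‖ ^ 2 * Real.exp ‖z‖ := by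
  simpa [Finset.sum_range_succ] using Complex.norm_exp_sub_sum_le_norm_mul_exp z 2

/-- First-order Edgeworth expansion, on the Fourier side, for normalized sums of independent
copies of a finitely supported centered random variable. -/
theorem exists_norm_charFun_pow_sub_edgeworth_le {ι : Type*} [Fintype ι] {p b : ι → ℝ}
    (hp : ∀ i, 0 ≤ p i) (hsum : ∑ i, p i = 1) (hmean : ∑ i, p i * b i = 0) :
    ∃ C : ℝ, ∀ N : ℕ, 1 ≤ N →
      ‖(∑ i, (p i : ℂ) * Complex.exp (Complex.I * (b i / √N : ℝ))) ^ N -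
        (1 + Complex.I * ((-(∑ i, p i * b i ^ 3) / 6 : ℝ) : ℂ) / (√N : ℂ)) *
          Complex.exp ((-(∑ i, p i * b i ^ 2) / 2 : ℝ) : ℂ)‖ ≤ C / N := by
  set V := ∑ i, p i * b i ^ 2 with hV
  set q := -(∑ i, p i * b i ^ 3) / 6 with hq
  have hV0 : 0 ≤ V := Finset.sum_nonneg fun i _ ↦ mul_nonneg (hp i) (sq_nonneg _)
  set K := ∑ i, p i * (|b i| ^ 4 * Real.exp |b i|)
  set M := V / 2 + |q| with hM
  have hM0 : 0 ≤ M := by positivity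
  refine ⟨K + M ^ 2 * Real.exp M + |q| ^ 2 * Real.exp |q|, fun N hN ↦ ?_⟩
  have hN1 : (1 : ℝ) ≤ N := mod_cast hN
  have hN0 : (0 : ℝ) < N := by linarith
  obtain ⟨t, ht⟩ : ∃ t : ℝ, t = (√N)⁻¹ := ⟨_, rfl⟩
  have ht0 : 0 ≤ t := by rw [ht]; positivity
  have ht1 : t ≤ 1 := by
    rw [ht]; exact inv_le_one_of_one_le₀ (Real.one_le_sqrt.2 hN1)
  have ht2 : t ^ 2 = (N : ℝ)⁻¹ := by rw [ht, inv_pow, Real.sq_sqrt hN0.le]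
  have hNt : (N : ℝ) * t ^ 2 = 1 := by rw [ht2]; exact mul_inv_cancel₀ hN0.ne'
  have hNtc : (N : ℂ) * (t : ℂ) ^ 2 = 1 := mod_cast hNt
  have hphi := norm_charFun_sub_cubic_le hp hsum hmean (t := t) (by rwa [abs_of_nonneg ht0])
  rw [← hV] at hphi
  have hdiv : ∀ i, b i / √N = t * b i := fun i ↦ by rw [ht, div_eq_inv_mul]
  simp only [hdiv]
  set A := ∑ i, (p i : ℂ) * Complex.exp (Complex.I * (t * b i : ℝ)) with hA
  set z : ℂ := ((-(V * t ^ 2 / 2) : ℝ) : ℂ) + ((q * t ^ 3 : ℝ) : ℂ) * Complex.I with hz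
  have hA1 : ‖A‖ ≤ 1 := by
    rw [← hsum]
    refine norm_sum_le_of_le _ fun i _ ↦ ?_
    rw [norm_mul, mul_comm Complex.I, Complex.norm_exp_ofReal_mul_I, mul_one, Complex.norm_real,
      Real.norm_of_nonneg (hp i)]
  have hB1 : ‖Complex.exp z‖ ≤ 1 := by
    rw [Complex.norm_exp, Real.exp_le_one_iff]
    simp only [hz, Complex.add_re, Complex.ofReal_re, Complex.re_ofReal_mul, Complex.I_re]
    have := mul_nonneg hV0 (sq_nonneg t)
    linarith
  have hz_le : ‖z‖ ≤ M * t ^ 2 := by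
    have h32 : t ^ 3 ≤ t ^ 2 := pow_le_pow_of_le_one ht0 ht1 (by norm_num)
    calc ‖z‖ ≤ V * t ^ 2 / 2 + |q| * t ^ 3 := by
          refine (norm_add_le _ _).trans (le_of_eq ?_)
          rw [norm_mul, Complex.norm_I, mul_one, Complex.norm_real, Complex.norm_real,
            Real.norm_eq_abs, Real.norm_eq_abs, abs_neg, abs_of_nonneg (by positivity), abs_mul,
            abs_of_nonneg (by positivity : 0 ≤ t ^ 3)]
      _ ≤ V * t ^ 2 / 2 + |q| * t ^ 2 := by gcongr
      _ = M * t ^ 2 := by rw [hM]; ring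
  have hz_exp : ‖Complex.exp z - (1 + z)‖ ≤ M ^ 2 * Real.exp M * t ^ 4 :=
    calc _ ≤ ‖z‖ ^ 2 * Real.exp ‖z‖ := norm_exp_sub_one_sub_le z
      _ ≤ (M * t ^ 2) ^ 2 * Real.exp M := by
          gcongr
          exact hz_le.trans (mul_le_of_le_one_right hM0 (pow_le_one₀ ht0 ht1))
      _ = _ := by ring
  have hz_eq : 1 - (V : ℂ) * t ^ 2 / 2 - Complex.I * (∑ i, p i * b i ^ 3 : ℝ) * t ^ 3 / 6
      = 1 + z := by
    rw [hz, hq]; push_cast; ring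
  rw [hz_eq] at hphi
  have hAB : ‖A - Complex.exp z‖ ≤ (K + M ^ 2 * Real.exp M) * t ^ 4 := by
    have := norm_sub_le_norm_sub_add_norm_sub A (1 + z) (Complex.exp z)
    rw [norm_sub_rev (1 + z)] at this
    linarith
  have hpow : ‖A ^ N - Complex.exp z ^ N‖ ≤ (K + M ^ 2 * Real.exp M) * t ^ 2 :=
    calc _ ≤ N * ‖A - Complex.exp z‖ := norm_pow_sub_pow_le_mul hA1 hB1 N
      _ ≤ N * ((K + M ^ 2 * Real.exp M) * t ^ 4) := by gcongr
      _ = (K + M ^ 2 * Real.exp M) * t ^ 2 * (N * t ^ 2) := by ring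
      _ = _ := by rw [hNt, mul_one]
  have hexpN : Complex.exp z ^ N =
      Complex.exp (Complex.I * (q * t : ℝ)) * Complex.exp ((-V / 2 : ℝ) : ℂ) := by
    rw [← Complex.exp_nat_mul, ← Complex.exp_add, hz]
    congr 1
    push_cast
    linear_combination (-(V : ℂ) / 2 + q * t * Complex.I) * hNtc
  have hcubic : ‖Complex.exp (Complex.I * (q * t : ℝ)) - (1 + Complex.I * (q * t : ℝ))‖ ≤
      |q| ^ 2 * Real.exp |q| * t ^ 2 := by
    have hnorm : ‖Complex.I * ((q * t : ℝ) : ℂ)‖ = |q| * t := by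
      rw [norm_mul, Complex.norm_I, one_mul, Complex.norm_real, Real.norm_eq_abs, abs_mul,
        abs_of_nonneg ht0]
    calc _ ≤ (|q| * t) ^ 2 * Real.exp (|q| * t) := hnorm ▸ norm_exp_sub_one_sub_le _
      _ ≤ (|q| * t) ^ 2 * Real.exp |q| := by
          gcongr
          exact mul_le_of_le_one_right (abs_nonneg _) ht1
      _ = _ := by ring
  have hgauss : ‖Complex.exp ((-V / 2 : ℝ) : ℂ)‖ ≤ 1 := by
    rw [Complex.norm_exp, Real.exp_le_one_iff, Complex.ofReal_re]
    linarith
  have htarget : Complex.I * (q : ℂ) / (√N : ℂ) = Complex.I * (q * t : ℝ) := by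
    rw [ht]; push_cast; rw [div_eq_mul_inv, mul_assoc]
  rw [htarget]
  have hlast : ‖Complex.exp z ^ N -
      (1 + Complex.I * (q * t : ℝ)) * Complex.exp ((-V / 2 : ℝ) : ℂ)‖ ≤
      |q| ^ 2 * Real.exp |q| * t ^ 2 := by
    rw [hexpN, ← sub_mul, norm_mul]
    exact (mul_le_of_le_one_right (norm_nonneg _) hgauss).trans hcubic
  have htri := norm_sub_le_norm_sub_add_norm_sub (A ^ N) (Complex.exp z ^ N)
    ((1 + Complex.I * (q * t : ℝ)) * Complex.exp ((-V / 2 : ℝ) : ℂ))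
  rw [div_eq_mul_inv _ (N : ℝ), ← ht2]
  linarith

theorem finsum_multProb_mul_prod_pow (k N : ℕ) (p : Fin k → ℝ) (u : Fin k → ℂ) :
    ∑ᶠ l ∈ {l : Fin k → ℕ | ∑ i, l i = N}, (multProb k N p l : ℂ) * ∏ i, u i ^ l i =
      (∑ i, (p i : ℂ) * u i) ^ N := by
  have hset : {l : Fin k → ℕ | ∑ i, l i = N} =
      ((Finset.piAntidiag Finset.univ N : Finset (Fin k → ℕ)) : Set (Fin k → ℕ)) := by
    ext l; simp
  rw [hset, finsum_mem_coe_finset, Finset.sum_pow_eq_sum_piAntidiag]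
  refine Finset.sum_congr rfl fun l hl ↦ ?_
  obtain ⟨rfl, -⟩ := Finset.mem_piAntidiag.1 hl
  have hspec : (∏ i, ((l i).factorial : ℂ)) * Nat.multinomial Finset.univ l =
      ((∑ i, l i).factorial : ℂ) := mod_cast Nat.multinomial_spec Finset.univ l
  have hne : (∏ i, ((l i).factorial : ℂ)) ≠ 0 :=
    Finset.prod_ne_zero_iff.2 fun i _ ↦ Nat.cast_ne_zero.2 (Nat.factorial_ne_zero _)
  rw [multProb]
  push_cast
  simp only [mul_pow, Finset.prod_mul_distrib]
  rw [← hspec, mul_div_cancel_left₀ _ hne, mul_assoc]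

/-- There is a homogeneous polynomial `Q` of degree three such that the
characteristic function of the rescaled multinomial variables `ξ_j = (λ_j - Np_j)/√(Np_j)`
satisfies
`E[exp(i Σ x_j ξ_j)] = (1 + iQ(x)/√N) exp(-½Σx_j² + ½(Σ√(p_j)x_j)²) + O(1/N)`. -/
theorem multinomial_char_fun_expansion
    (k : ℕ) (hk : 0 < k) (p : Fin k → ℝ)
    (hp : ∀ i, 0 < p i ∧ p i < 1) (hsum : ∑ i, p i = 1) :
    ∃ Q : MvPolynomial (Fin k) ℝ, Q.IsHomogeneous 3 ∧
      ∀ x : Fin k → ℝ, ∃ C : ℝ, ∀ N : ℕ, 1 ≤ N →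
        ‖(∑ᶠ l ∈ {l : Fin k → ℕ | ∑ i, l i = N},
            (multProb k N p l : ℂ) *
              Complex.exp (Complex.I *
                ((∑ j, x j * (((l j : ℝ) - N * p j) / Real.sqrt (N * p j)) : ℝ) : ℂ))) -
          (1 + Complex.I * ((MvPolynomial.eval x Q : ℝ) : ℂ) / (Real.sqrt N : ℂ)) *
            Complex.exp
              (((-(∑ j, (x j) ^ 2) / 2 + (∑ j, Real.sqrt (p j) * x j) ^ 2 / 2 : ℝ)) : ℂ)‖ ≤
          C / N := by
  let L : Fin k → MvPolynomial (Fin k) ℝ := fun i ↦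
    MvPolynomial.C (√(p i))⁻¹ * MvPolynomial.X i
      - ∑ j, MvPolynomial.C √(p j) * MvPolynomial.X j
  have hL : ∀ i, (L i).IsHomogeneous 1 := fun i ↦
    ((MvPolynomial.isHomogeneous_X ℝ i).C_mul _).sub
      (MvPolynomial.IsHomogeneous.sum _ _ _ fun j _ ↦
        (MvPolynomial.isHomogeneous_X ℝ j).C_mul _)
  refine ⟨MvPolynomial.C (-1 / 6) * ∑ i, MvPolynomial.C (p i) * L i ^ 3,
    (MvPolynomial.IsHomogeneous.sum _ _ _ fun i _ ↦ ((hL i).pow 3).C_mul _).C_mul _, fun x ↦ ?_⟩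
  set m := ∑ j, √(p j) * x j with hm
  set b : Fin k → ℝ := fun i ↦ (√(p i))⁻¹ * x i - m with hb
  have hs : ∀ i, √(p i) ≠ 0 := fun i ↦ (Real.sqrt_pos.2 (hp i).1).ne'
  have hsq : ∀ i, p i = √(p i) ^ 2 := fun i ↦ (Real.sq_sqrt (hp i).1.le).symm
  have hpb : ∀ i, p i * b i = √(p i) * x i - p i * m := fun i ↦ by
    have : p i * (√(p i))⁻¹ = √(p i) := by
      nth_rw 1 [hsq i]; field_simp [hs i]
    simp only [hb]
    linear_combination x i * this
  have hmean : ∑ i, p i * b i = 0 := by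
    simp only [hpb, Finset.sum_sub_distrib, ← Finset.sum_mul, hsum, ← hm]
    ring
  have hvar : ∑ i, p i * b i ^ 2 = ∑ i, x i ^ 2 - m ^ 2 := by
    have hterm : ∀ i, p i * b i ^ 2 = x i ^ 2 - √(p i) * x i * m - m * (p i * b i) := fun i ↦ by
      have h₁ : √(p i) * (√(p i))⁻¹ = 1 := mul_inv_cancel₀ (hs i)
      have h₂ : b i = (√(p i))⁻¹ * x i - m := rfl
      linear_combination b i * hpb i + √(p i) * x i * h₂ + x i ^ 2 * h₁
    simp only [hterm, Finset.sum_sub_distrib, ← Finset.sum_mul, ← Finset.mul_sum, hmean, ← hm]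
    ring
  have hQ : MvPolynomial.eval x (MvPolynomial.C (-1 / 6) * ∑ i, MvPolynomial.C (p i) * L i ^ 3) =
      -(∑ i, p i * b i ^ 3) / 6 := by
    simp only [L, hb, hm, map_mul, map_sum, map_sub, map_pow, MvPolynomial.eval_C,
      MvPolynomial.eval_X]
    ring
  obtain ⟨C, hC⟩ := exists_norm_charFun_pow_sub_edgeworth_le (fun i ↦ (hp i).1.le) hsum hmean
  refine ⟨C, fun N hN ↦ ?_⟩
  have hN0 : (0 : ℝ) < N := mod_cast hN
  have hsN : √(N : ℝ) ≠ 0 := (Real.sqrt_pos.2 hN0).ne'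
  have hexponent : ∀ l : Fin k → ℕ, ∑ i, l i = N →
      ∑ j, x j * (((l j : ℝ) - N * p j) / √(N * p j)) = ∑ j, l j * (b j / √N) := by
    intro l hl
    have hlr : ∑ i, (l i : ℝ) = N := mod_cast hl
    have hterm : ∀ j, x j * (((l j : ℝ) - N * p j) / √(N * p j)) =
        l j * (b j / √N) + (l j * m / √N - N / √N * (√(p j) * x j)) := fun j ↦ by
      have := hs j
      rw [Real.sqrt_mul hN0.le]
      simp only [hb]
      field_simp
      linear_combination (-(x j * N)) * hsq j
    simp only [hterm, Finset.sum_add_distrib, Finset.sum_sub_distrib, ← Finset.mul_sum,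
      ← Finset.sum_div, ← Finset.sum_mul, hlr, ← hm]
    ring
  have hchar : (∑ᶠ l ∈ {l : Fin k → ℕ | ∑ i, l i = N}, (multProb k N p l : ℂ) *
      Complex.exp (Complex.I *
        ((∑ j, x j * (((l j : ℝ) - N * p j) / √(N * p j)) : ℝ) : ℂ))) =
      (∑ i, (p i : ℂ) * Complex.exp (Complex.I * (b i / √N : ℝ))) ^ N := by
    rw [← finsum_multProb_mul_prod_pow]
    refine finsum_mem_congr rfl fun l hl ↦ ?_
    rw [hexponent l hl]
    simp only [← Complex.exp_nat_mul, ← Complex.exp_sum]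
    congr 2
    push_cast
    rw [Finset.mul_sum]
    exact Finset.sum_congr rfl fun i _ ↦ by ring
  rw [hchar, hQ, show -(∑ j, x j ^ 2) / 2 + m ^ 2 / 2 = -(∑ i, p i * b i ^ 2) / 2 by
    rw [hvar]; ring]
  exact hC N hN

end
end

section
/- If the sequence q₁,…,q_k is not weakly decreasing, i.e. q_i < q_{i+1} for some i, then the multinomial mass of weakly decreasing tuples is exponentially small: there exist constants C, δ > 0 such that Σ_{λ₁ ≥ λ₂ ≥ ⋯ ≥ λ_k ≥ 0, Σλ_i = N} M_q(λ) ≤ C e^{−δN} for all N. -/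
open MeasureTheory Filter
open scoped Classical

noncomputable section

lemma pow_mul_pow_le_sqrt_pow {x y : ℝ} (hx : 0 ≤ x) (hxy : x ≤ y) {a b : ℕ} (hba : b ≤ a) :
    x ^ a * y ^ b ≤ √(x * y) ^ a * √(x * y) ^ b := by
  obtain ⟨c, rfl⟩ := Nat.exists_eq_add_of_le hba
  have hs : √(x * y) * √(x * y) = x * y := Real.mul_self_sqrt (mul_nonneg hx (hx.trans hxy))
  have hxs : x ≤ √(x * y) := Real.le_sqrt_of_sq_le (by nlinarith)
  calc x ^ (b + c) * y ^ b = (x * y) ^ b * x ^ c := by rw [mul_pow]; ring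
    _ ≤ (x * y) ^ b * √(x * y) ^ c := by
        have := hx.trans hxy
        gcongr
    _ = (√(x * y) * √(x * y)) ^ b * √(x * y) ^ c := by rw [hs]
    _ = √(x * y) ^ (b + c) * √(x * y) ^ b := by rw [mul_pow]; ring

lemma two_mul_sqrt_mul_lt_add {x y : ℝ} (hx : 0 ≤ x) (hxy : x < y) :
    2 * √(x * y) < x + y := by
  have hs : √x < √y := Real.sqrt_lt_sqrt hx hxy
  rw [Real.sqrt_mul hx]
  nlinarith [Real.mul_self_sqrt hx, Real.mul_self_sqrt (hx.trans hxy.le),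
    mul_pos (sub_pos.2 hs) (sub_pos.2 hs)]

lemma multProb_nonneg {k : ℕ} (N : ℕ) {p : Fin k → ℝ} (hp : ∀ i, 0 ≤ p i) (l : Fin k → ℕ) :
    0 ≤ multProb k N p l :=
  mul_nonneg (by positivity) (Finset.prod_nonneg fun i _ => pow_nonneg (hp i) _)

lemma sum_multProb_piAntidiag (k N : ℕ) (p : Fin k → ℝ) :
    ∑ l ∈ Finset.piAntidiag Finset.univ N, multProb k N p l = (∑ i, p i) ^ N := by
  rw [Finset.sum_pow_eq_sum_piAntidiag]
  refine Finset.sum_congr rfl fun l hl => ?_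
  have hl' : ∑ i, l i = N := (Finset.mem_piAntidiag.1 hl).1
  have h : (∏ i, ((l i).factorial : ℝ)) * (Nat.multinomial Finset.univ l : ℝ) = N.factorial := by
    have := Nat.multinomial_spec Finset.univ l
    rw [hl'] at this
    exact_mod_cast this
  have h0 : (∏ i, ((l i).factorial : ℝ)) ≠ 0 :=
    Finset.prod_ne_zero_iff.2 fun i _ => by positivity
  rw [multProb, ← h, mul_div_cancel_left₀ _ h0]

/-- Replacing two weights `q i ≤ q j` by their geometric mean does not decrease the
multinomial weight of a tuple with `l j ≤ l i`. -/
lemma multProb_le_multProb_update {k : ℕ} (N : ℕ) {q : Fin k → ℝ} (hq : ∀ i, 0 ≤ q i)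
    {i j : Fin k} (hij : i ≠ j) (hle : q i ≤ q j) {l : Fin k → ℕ} (hl : l j ≤ l i) :
    multProb k N q l ≤
      multProb k N (Function.update (Function.update q i √(q i * q j)) j √(q i * q j)) l := by
  unfold multProb
  refine mul_le_mul_of_nonneg_left ?_ (by positivity)
  have hj : j ∈ Finset.univ.erase i := by simp [hij.symm]
  rw [← Finset.mul_prod_erase _ _ (Finset.mem_univ i), ← Finset.mul_prod_erase _ _ hj,
    ← Finset.mul_prod_erase _ _ (Finset.mem_univ i), ← Finset.mul_prod_erase _ _ hj,
    ← mul_assoc, ← mul_assoc]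
  have hrest : ∏ x ∈ (Finset.univ.erase i).erase j,
      Function.update (Function.update q i √(q i * q j)) j √(q i * q j) x ^ l x =
      ∏ x ∈ (Finset.univ.erase i).erase j, q x ^ l x := by
    refine Finset.prod_congr rfl fun x hx => ?_
    simp only [Finset.mem_erase] at hx
    rw [Function.update_of_ne hx.1, Function.update_of_ne hx.2.1]
  rw [hrest, Function.update_self, Function.update_of_ne hij, Function.update_self]
  exact mul_le_mul_of_nonneg_right (pow_mul_pow_le_sqrt_pow (hq i) hle hl)
    (Finset.prod_nonneg fun x _ => pow_nonneg (hq x) _)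

lemma sum_update_sqrt_lt {k : ℕ} {q : Fin k → ℝ} {i j : Fin k} (hi : 0 ≤ q i)
    (hlt : q i < q j) :
    ∑ x, Function.update (Function.update q i √(q i * q j)) j √(q i * q j) x < ∑ x, q x := by
  have hij : i ≠ j := fun h => hlt.ne (congrArg q h)
  have hj : j ∈ Finset.univ.erase i := by simp [hij.symm]
  rw [← Finset.add_sum_erase _ _ (Finset.mem_univ i), ← Finset.add_sum_erase _ _ hj,
    ← Finset.add_sum_erase _ q (Finset.mem_univ i), ← Finset.add_sum_erase _ q hj]
  have hrest : ∑ x ∈ (Finset.univ.erase i).erase j,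
      Function.update (Function.update q i √(q i * q j)) j √(q i * q j) x =
      ∑ x ∈ (Finset.univ.erase i).erase j, q x := by
    refine Finset.sum_congr rfl fun x hx => ?_
    simp only [Finset.mem_erase] at hx
    rw [Function.update_of_ne hx.1, Function.update_of_ne hx.2.1]
  rw [hrest, Function.update_self, Function.update_of_ne hij, Function.update_self]
  linarith [two_mul_sqrt_mul_lt_add hi hlt]

/-- If the sequence `q₁,…,q_k` is not weakly decreasing (`q_i < q_{i+1}`
for some `i`), then the multinomial mass of the set of weakly decreasing tuples is
exponentially small. -/
theorem multinomial_decreasing_mass_small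
    (k : ℕ) (hk : 2 ≤ k) (q : Fin k → ℝ)
    (hq : ∀ i, 0 < q i ∧ q i < 1) (hsum : ∑ i, q i = 1)
    (hnot : ∃ i j : Fin k, (j : ℕ) = (i : ℕ) + 1 ∧ q i < q j) :
    ∃ C δ : ℝ, 0 < C ∧ 0 < δ ∧ ∀ N : ℕ,
      (∑ᶠ l ∈ {l : Fin k → ℕ | Antitone l ∧ ∑ i, l i = N},
        multProb k N q l) ≤ C * Real.exp (-δ * N) := by
  obtain ⟨i, j, hval, hlt⟩ := hnot
  have hij : i < j := Fin.lt_def.2 (by omega)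
  set p := Function.update (Function.update q i √(q i * q j)) j √(q i * q j) with hp
  have hpos : ∀ x, 0 < p x := by
    have hs : 0 < √(q i * q j) := Real.sqrt_pos.2 (mul_pos (hq i).1 (hq j).1)
    intro x
    rw [hp, Function.update_apply, Function.update_apply]
    split_ifs
    exacts [hs, hs, (hq x).1]
  have hr1 : ∑ x, p x < 1 := hsum ▸ sum_update_sqrt_lt (hq i).1.le hlt
  have hr0 : 0 < ∑ x, p x := Finset.sum_pos (fun x _ => hpos x) ⟨i, Finset.mem_univ i⟩
  refine ⟨1, -Real.log (∑ x, p x), one_pos, neg_pos.2 (Real.log_neg hr0 hr1), fun N => ?_⟩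
  have hset : {l : Fin k → ℕ | Antitone l ∧ ∑ i, l i = N} =
      ↑((Finset.piAntidiag Finset.univ N).filter fun l : Fin k → ℕ => Antitone l) := by
    ext l
    simp [and_comm]
  rw [hset, finsum_mem_coe_finset, neg_neg, one_mul, mul_comm, Real.exp_nat_mul,
    Real.exp_log hr0, ← sum_multProb_piAntidiag]
  calc _ ≤ ∑ l ∈ (Finset.piAntidiag Finset.univ N).filter fun l : Fin k → ℕ => Antitone l,
        multProb k N p l :=
        Finset.sum_le_sum fun l hl => multProb_le_multProb_update N (fun x => (hq x).1.le)
          hij.ne hlt.le ((Finset.mem_filter.1 hl).2 hij.le)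
    _ ≤ _ := Finset.sum_le_sum_of_subset_of_nonneg (Finset.filter_subset _ _)
        fun l _ _ => multProb_nonneg N (fun x => (hpos x).le) l

end
end

section
/- Asymptotics of the Vandermonde of shifted parts: fix ξ ∈ ℝ^k and let λ^{(N)} = (λ₁^{(N)},…,λ_k^{(N)}) be any sequences of integers such that (λ_i^{(N)} − N p_i)/√(N p_i) → ξ_i for each i. Set h_i = λ_i^{(N)} + k − i and Δ(h) = ∏_{1≤i<j≤k}(h_i − h_j). Then N^{−k(k−1)/2 + Σ_α k_α(k_α−1)/4} · Δ(h) converges, as N → ∞, to ∏_α p_α^{k_α(k_α−1)/4} · ∏_{α<β} (p_α − p_β)^{k_α k_β} · ∏_α Δ_α(ξ). -/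
open MeasureTheory Filter
open scoped Classical

noncomputable section

/-- The number of pairs `i < j` in `Fin k` is `k * (k - 1) / 2`. -/
lemma card_filter_fst_lt_snd_mul_two (k : ℕ) :
    (Finset.univ.filter fun q : Fin k × Fin k => q.1 < q.2).card * 2 = k * (k - 1) := by
  have h : (Finset.univ.filter fun q : Fin k × Fin k => q.1 < q.2).card
      = ∑ j : Fin k, (j : ℕ) := by
    rw [Finset.card_filter, Fintype.sum_prod_type_right]
    refine Finset.sum_congr rfl fun j _ => ?_
    rw [← Finset.card_filter, Finset.filter_gt_eq_Iio, Fin.card_Iio]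
  rw [h, Fin.sum_univ_eq_sum_range (fun i => i), Finset.sum_range_id_mul_two]

section Rescaling

variable {u v : ℕ → ℝ} {a b x y : ℝ}

/-- Normalizing by `√N` instead of `√(N a)` multiplies the limit by `√a`. -/
lemma tendsto_rpow_neg_half_mul_sub (ha : 0 < a)
    (hu : Tendsto (fun N : ℕ => (u N - N * a) / Real.sqrt (N * a)) atTop (nhds x)) :
    Tendsto (fun N : ℕ => (N : ℝ) ^ (-1 / 2 : ℝ) * (u N - N * a)) atTop
      (nhds (Real.sqrt a * x)) := by
  refine (hu.const_mul (Real.sqrt a)).congr' ?_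
  filter_upwards [eventually_gt_atTop 0] with N hN
  have hN' : (0 : ℝ) < N := by exact_mod_cast hN
  have hs : Real.sqrt a ≠ 0 := (Real.sqrt_pos.2 ha).ne'
  have ht : Real.sqrt N ≠ 0 := (Real.sqrt_pos.2 hN').ne'
  rw [neg_div, Real.rpow_neg hN'.le, ← Real.sqrt_eq_rpow, Real.sqrt_mul hN'.le]
  field_simp

lemma tendsto_natCast_rpow_neg {s : ℝ} (hs : s < 0) :
    Tendsto (fun N : ℕ => (N : ℝ) ^ s) atTop (nhds 0) := by
  have h := (tendsto_rpow_neg_atTop (neg_pos.2 hs)).comp (tendsto_natCast_atTop_atTop (R := ℝ))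
  simpa [Function.comp_def] using h

/-- Law of large numbers scaling: a sequence with `√N` fluctuations around `N a` is
asymptotic to `N a`. -/
lemma tendsto_rpow_neg_one_mul (ha : 0 < a)
    (hu : Tendsto (fun N : ℕ => (u N - N * a) / Real.sqrt (N * a)) atTop (nhds x)) :
    Tendsto (fun N : ℕ => (N : ℝ) ^ (-1 : ℝ) * u N) atTop (nhds a) := by
  have h := ((tendsto_natCast_rpow_neg (s := -1 / 2) (by norm_num)).mul
    (tendsto_rpow_neg_half_mul_sub ha hu)).add_const a
  rw [zero_mul, zero_add] at h
  refine h.congr' ?_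
  filter_upwards [eventually_gt_atTop 0] with N hN
  have hN' : (0 : ℝ) < N := by exact_mod_cast hN
  rw [← mul_assoc, ← Real.rpow_add hN', show (-1 / 2 + -1 / 2 : ℝ) = -1 by norm_num,
    Real.rpow_neg_one]
  field_simp
  ring

/-- Difference of two sequences fluctuating around the same centre. -/
lemma tendsto_rpow_neg_half_mul_shifted_sub (ha : 0 < a) (c d : ℝ)
    (hu : Tendsto (fun N : ℕ => (u N - N * a) / Real.sqrt (N * a)) atTop (nhds x))
    (hv : Tendsto (fun N : ℕ => (v N - N * a) / Real.sqrt (N * a)) atTop (nhds y)) :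
    Tendsto (fun N : ℕ => (N : ℝ) ^ (-1 / 2 : ℝ) * ((u N + c) - (v N + d))) atTop
      (nhds (Real.sqrt a * (x - y))) := by
  have h := ((tendsto_rpow_neg_half_mul_sub ha hu).sub
    (tendsto_rpow_neg_half_mul_sub ha hv)).add
    ((tendsto_natCast_rpow_neg (s := -1 / 2) (by norm_num)).mul_const (c - d))
  rw [zero_mul, add_zero, ← mul_sub] at h
  exact h.congr fun N => by ring

/-- Difference of two sequences fluctuating around centres `N a` and `N b`. -/
lemma tendsto_rpow_neg_one_mul_shifted_sub (ha : 0 < a) (hb : 0 < b) (c d : ℝ)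
    (hu : Tendsto (fun N : ℕ => (u N - N * a) / Real.sqrt (N * a)) atTop (nhds x))
    (hv : Tendsto (fun N : ℕ => (v N - N * b) / Real.sqrt (N * b)) atTop (nhds y)) :
    Tendsto (fun N : ℕ => (N : ℝ) ^ (-1 : ℝ) * ((u N + c) - (v N + d))) atTop
      (nhds (a - b)) := by
  have h := ((tendsto_rpow_neg_one_mul ha hu).sub (tendsto_rpow_neg_one_mul hb hv)).add
    ((tendsto_natCast_rpow_neg (s := -1) (by norm_num)).mul_const (c - d))
  rw [zero_mul, add_zero] at h
  exact h.congr fun N => by ring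

end Rescaling

/-- Asymptotics of the Vandermonde of the shifted parts
`h_i = λ_i^{(N)} + k - i` (here `0`-indexed: `h_i = λ_i + (k-1) - i`) when
`(λ_i^{(N)} - Np_i)/√(Np_i) → ξ_i`:
`N^{-k(k-1)/2 + Σ_α k_α(k_α-1)/4} Δ(h) → ∏_α p_α^{k_α(k_α-1)/4} ∏_{α<β}(p_α-p_β)^{k_αk_β} ∏_α Δ_α(ξ)`.
Block data is encoded through pairs: `Σ_α k_α(k_α-1)/2` is the number of pairs `i<j` with
`p i = p j`, `∏_α p_α^{k_α(k_α-1)/4}` is the product of `√(p i)` over such pairs,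
`∏_{α<β}(p_α-p_β)^{k_αk_β}` is the product of `p i - p j` over pairs `i<j` with `p i ≠ p j`,
and `∏_α Δ_α(ξ)` is the product of `ξ i - ξ j` over pairs `i<j` with `p i = p j`. -/
theorem vandermonde_shifted_parts_asymptotics
    (k : ℕ) (hk : 0 < k) (p : Fin k → ℝ)
    (hp : ∀ i, 0 < p i ∧ p i < 1) (hsum : ∑ i, p i = 1) (hmono : Antitone p)
    (ξ : Fin k → ℝ) (l : ℕ → Fin k → ℕ)
    (hl : ∀ i : Fin k, Tendsto
      (fun N : ℕ => ((l N i : ℝ) - N * p i) / Real.sqrt (N * p i)) atTop (nhds (ξ i))) :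
    Tendsto
      (fun N : ℕ => (N : ℝ) ^
          (-(((k * (k - 1) : ℕ) : ℝ)) / 2 +
            ((Finset.univ.filter fun q : Fin k × Fin k =>
                q.1 < q.2 ∧ p q.1 = p q.2).card : ℝ) / 2) *
        ∏ q ∈ Finset.univ.filter fun q : Fin k × Fin k => q.1 < q.2,
          (((l N q.1 : ℝ) + ((k - 1 - (q.1 : ℕ) : ℕ) : ℝ)) -
            ((l N q.2 : ℝ) + ((k - 1 - (q.2 : ℕ) : ℕ) : ℝ))))
      atTop
      (nhds (
        (∏ q ∈ Finset.univ.filter fun q : Fin k × Fin k => q.1 < q.2 ∧ p q.1 = p q.2,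
          Real.sqrt (p q.1)) *
        (∏ q ∈ Finset.univ.filter fun q : Fin k × Fin k => q.1 < q.2 ∧ p q.1 ≠ p q.2,
          (p q.1 - p q.2)) *
        (∏ q ∈ Finset.univ.filter fun q : Fin k × Fin k => q.1 < q.2 ∧ p q.1 = p q.2,
          (ξ q.1 - ξ q.2)))) := by
  set S := Finset.univ.filter fun q : Fin k × Fin k => q.1 < q.2
  have hE : Finset.univ.filter (fun q : Fin k × Fin k => q.1 < q.2 ∧ p q.1 = p q.2)
      = S.filter fun q => p q.1 = p q.2 := (Finset.filter_filter _ _ _).symm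
  have hD : Finset.univ.filter (fun q : Fin k × Fin k => q.1 < q.2 ∧ p q.1 ≠ p q.2)
      = S.filter fun q => ¬ p q.1 = p q.2 := (Finset.filter_filter _ _ _).symm
  rw [hE, hD]
  set E := S.filter fun q => p q.1 = p q.2
  set D := S.filter fun q => ¬ p q.1 = p q.2
  have hcard : -((k * (k - 1) : ℕ) : ℝ) / 2 + (E.card : ℝ) / 2
      = (-1 / 2) * E.card + (-1) * D.card := by
    have h1 : S.card * 2 = k * (k - 1) := card_filter_fst_lt_snd_mul_two k
    have h2 : E.card + D.card = S.card := Finset.card_filter_add_card_filter_not _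
    rw [← h1, ← h2]
    push_cast
    ring
  have hEq := tendsto_finsetProd E fun q hq =>
    tendsto_rpow_neg_half_mul_shifted_sub (hp q.1).1 ((k - 1 - (q.1 : ℕ) : ℕ) : ℝ)
      ((k - 1 - (q.2 : ℕ) : ℕ) : ℝ) (hl q.1)
      (by rw [(Finset.mem_filter.1 hq).2]; exact hl q.2)
  have hNe := tendsto_finsetProd D fun q _ =>
    tendsto_rpow_neg_one_mul_shifted_sub (hp q.1).1 (hp q.2).1
      ((k - 1 - (q.1 : ℕ) : ℕ) : ℝ) ((k - 1 - (q.2 : ℕ) : ℕ) : ℝ) (hl q.1) (hl q.2)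
  have h := hEq.mul hNe
  rw [Finset.prod_mul_distrib, mul_right_comm] at h
  refine h.congr' ?_
  filter_upwards [eventually_gt_atTop 0] with N hN
  have hN' : (0 : ℝ) < N := by exact_mod_cast hN
  rw [hcard, Real.rpow_add hN', Real.rpow_mul_natCast hN'.le, Real.rpow_mul_natCast hN'.le,
    ← Finset.prod_filter_mul_prod_filter_not S (fun q => p q.1 = p q.2),
    Finset.prod_mul_distrib, Finset.prod_mul_distrib, Finset.prod_const, Finset.prod_const]
  ring

end
end

section
/- Schur polynomial at repeated arguments: let p₁ > p₂ > ⋯ > p_m > 0 be distinct positive reals with multiplicities k₁,…,k_m and k = k₁+⋯+k_m, and let q ∈ ℝ^k be the weakly decreasing list containing each p_α exactly k_α times. Partition {1,…,k} into consecutive blocks A₁,…,A_m of sizes k₁,…,k_m and set i_α = max A_α. For a partition λ with at most k parts set h_j = λ_j + k − j. Then s_λ(q) = det(B)/Δ'(p), where B is the k×k matrix with entry B_{ij} = h_j^{i_α − i} · p_α^{h_j − i_α + i} for i ∈ A_α (interpreting p_α raised to a possibly negative integer power), and Δ'(p) = ∏_α (1!·2!⋯(k_α−1)!) · ∏_{α<β}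 (p_α − p_β)^{k_α k_β}. -/
open MeasureTheory Filter
open scoped Classical

noncomputable section

/-- Newton interpolation coefficients of `X ^ n` at the nodes `x (k - 1), …, x 0`: the
coefficient with index `r` belongs to the product of `X - x i` over the last `r` nodes. -/
def newtonCoeff : (k : ℕ) → (Fin k → ℝ) → ℕ → Fin k → ℝ
  | 0, _, _ => Fin.elim0
  | k + 1, x, n => Fin.cons (x (Fin.last k) ^ n) fun r =>
      ∑ g ∈ Finset.range n,
        x (Fin.last k) ^ (n - 1 - g) * newtonCoeff k (fun i => x i.castSucc) g r

lemma newtonCoeff_succ_zero {k : ℕ} (x : Fin (k + 1) → ℝ) (n : ℕ) :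
    newtonCoeff (k + 1) x n 0 = x (Fin.last k) ^ n := by
  simp [newtonCoeff]

lemma newtonCoeff_succ_succ {k : ℕ} (x : Fin (k + 1) → ℝ) (n : ℕ) (r : Fin k) :
    newtonCoeff (k + 1) x n r.succ = ∑ g ∈ Finset.range n,
      x (Fin.last k) ^ (n - 1 - g) * newtonCoeff k (fun i => x i.castSucc) g r := by
  simp [newtonCoeff]

lemma newtonCoeff_succ_succ_eq_add {k : ℕ} (x : Fin (k + 1) → ℝ) {a n : ℕ} (h : a ≤ n)
    (r : Fin k) :
    newtonCoeff (k + 1) x n r.succ =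
      ∑ g ∈ Finset.Ico a n,
        x (Fin.last k) ^ (n - 1 - g) * newtonCoeff k (fun i => x i.castSucc) g r +
      x (Fin.last k) ^ (n - a) * newtonCoeff (k + 1) x a r.succ := by
  rw [newtonCoeff_succ_succ, newtonCoeff_succ_succ, ← Finset.sum_range_add_sum_Ico _ h, add_comm,
    Finset.mul_sum]
  congr 1
  refine Finset.sum_congr rfl fun g hg => ?_
  rw [Finset.mem_range] at hg
  rw [← mul_assoc, ← pow_add]
  congr 2
  omega

lemma det_newtonCoeff_succ {k : ℕ} (x : Fin (k + 1) → ℝ) (h : Fin (k + 1) → ℕ)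
    (hh : Monotone h) :
    Matrix.det (Matrix.of fun j r => newtonCoeff (k + 1) x (h j) r) =
      x (Fin.last k) ^ h 0 *
        ∑ g ∈ Fintype.piFinset fun j : Fin k => Finset.Ico (h j.castSucc) (h j.succ),
          (∏ j, x (Fin.last k) ^ (h j.succ - 1 - g j)) *
            Matrix.det (Matrix.of fun j r => newtonCoeff k (fun i => x i.castSucc) (g j) r) := by
  let N : Matrix (Fin k) (Fin k) ℝ := fun j => ∑ g ∈ Finset.Ico (h j.castSucc) (h j.succ),
    x (Fin.last k) ^ (h j.succ - 1 - g) • newtonCoeff k (fun i => x i.castSucc) g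
  let B : Matrix (Fin (k + 1)) (Fin (k + 1)) ℝ :=
    Fin.cons (newtonCoeff (k + 1) x (h 0)) fun j => Fin.cons 0 (N j)
  have hB : Matrix.det (Matrix.of fun j r => newtonCoeff (k + 1) x (h j) r) = B.det := by
    refine Matrix.det_eq_of_forall_row_eq_smul_add_pred
      (fun j => x (Fin.last k) ^ (h j.succ - h j.castSucc)) (fun r => rfl) fun j r => ?_
    have hj : h j.castSucc ≤ h j.succ := hh (Fin.castSucc_lt_succ).le
    refine Fin.cases ?_ (fun r => ?_) r
    · simp [B, newtonCoeff_succ_zero, ← pow_add, hj]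
    · simp only [Matrix.of_apply, B, N, Fin.cons_succ, Finset.sum_apply, Pi.smul_apply, smul_eq_mul]
      exact newtonCoeff_succ_succ_eq_add x hj r
  have hN : B.det = x (Fin.last k) ^ h 0 * N.det := by
    rw [Matrix.det_succ_column_zero, Fin.sum_univ_succ]
    have h1 : B.submatrix (Fin.succAbove 0) Fin.succ = N := rfl
    rw [h1]
    simp [B, newtonCoeff_succ_zero]
  rw [hB, hN]
  congr 1
  have h2 := (Matrix.detRowAlternating (n := Fin k) (R := ℝ)).toMultilinearMap.map_sum_finset
    (fun j g => x (Fin.last k) ^ (h j.succ - 1 - g) • newtonCoeff k (fun i => x i.castSucc) g)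
    (fun j => Finset.Ico (h j.castSucc) (h j.succ))
  refine h2.trans (Finset.sum_congr rfl fun g _ => ?_)
  exact (MultilinearMap.map_smul_univ _ _ _)

lemma prod_dvd_X_pow_sub_sum_newtonCoeff (k : ℕ) (x : Fin k → ℝ) (n : ℕ) :
    (∏ i, (Polynomial.X - Polynomial.C (x i))) ∣
      Polynomial.X ^ n - ∑ r, Polynomial.C (newtonCoeff k x n r) *
        ∏ i with Fin.rev i < r, (Polynomial.X - Polynomial.C (x i)) := by
  induction k generalizing n with
  | zero => simp
  | succ k ih =>
    have hP (r : Fin k) : ∏ i with Fin.rev i < r.succ, (Polynomial.X - Polynomial.C (x i)) =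
        (∏ i : Fin k with Fin.rev i < r, (Polynomial.X - Polynomial.C (x i.castSucc))) *
          (Polynomial.X - Polynomial.C (x (Fin.last k))) := by
      simp [Finset.prod_filter, Fin.prod_univ_castSucc, Fin.rev_castSucc]
    have hg : (Polynomial.X : Polynomial ℝ) ^ n = Polynomial.C (x (Fin.last k)) ^ n +
        (∑ g ∈ Finset.range n, Polynomial.X ^ g * Polynomial.C (x (Fin.last k)) ^ (n - 1 - g)) *
          (Polynomial.X - Polynomial.C (x (Fin.last k))) := by
      rw [(Commute.all _ _).geom_sum₂_mul]; ring
    have key : Polynomial.X ^ n - ∑ r, Polynomial.C (newtonCoeff (k + 1) x n r) *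
        ∏ i with Fin.rev i < r, (Polynomial.X - Polynomial.C (x i)) =
        (∑ g ∈ Finset.range n, (Polynomial.X ^ g -
          ∑ r, Polynomial.C (newtonCoeff k (fun i => x i.castSucc) g r) *
            ∏ i with Fin.rev i < r, (Polynomial.X - Polynomial.C (x i.castSucc))) *
            Polynomial.C (x (Fin.last k)) ^ (n - 1 - g)) *
          (Polynomial.X - Polynomial.C (x (Fin.last k))) := by
      rw [Fin.sum_univ_succ]
      simp only [hP, newtonCoeff_succ_zero, newtonCoeff_succ_succ]
      rw [hg]
      simp only [sub_mul, Finset.sum_sub_distrib, map_sum, map_mul, map_pow, Finset.sum_mul]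
      rw [Finset.sum_comm (s := Finset.range n)]
      simp
      refine Finset.sum_congr rfl fun r _ => Finset.sum_congr rfl fun g _ => ?_
      ring
    rw [key, Fin.prod_univ_castSucc]
    exact mul_dvd_mul_right (Finset.dvd_sum fun g _ => (ih _ g).mul_right _) _

/-- Extend a tableau of shape `μ` by cells labelled `k` to a tableau of shape `l`. -/
def extendTableau {k : ℕ} (l : Fin (k + 1) → ℕ) (μ : Fin k → ℕ) (T : Fin k × ℕ → ℕ) :
    Fin (k + 1) × ℕ → ℕ := fun c =>
  Fin.snoc (α := fun _ => ℕ)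
    (fun i => if c.2 < μ i then T (i, c.2) else if c.2 < l i.castSucc then k else 0)
    (if c.2 < l (Fin.last k) then k else 0) c.1

lemma extendTableau_castSucc {k : ℕ} (l : Fin (k + 1) → ℕ) (μ : Fin k → ℕ)
    (T : Fin k × ℕ → ℕ) (i : Fin k) (j : ℕ) :
    extendTableau l μ T (i.castSucc, j) =
      if j < μ i then T (i, j) else if j < l i.castSucc then k else 0 := by
  simp [extendTableau]

lemma extendTableau_last {k : ℕ} (l : Fin (k + 1) → ℕ) (μ : Fin k → ℕ)
    (T : Fin k × ℕ → ℕ) (j : ℕ) :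
    extendTableau l μ T (Fin.last k, j) = if j < l (Fin.last k) then k else 0 := by
  simp [extendTableau]

/-- The sequences interlacing with `l`. -/
def interlacing {k : ℕ} (l : Fin (k + 1) → ℕ) : Finset (Fin k → ℕ) :=
  Fintype.piFinset fun i => Finset.Icc (l i.succ) (l i.castSucc)

lemma mem_interlacing {k : ℕ} {l : Fin (k + 1) → ℕ} {μ : Fin k → ℕ} :
    μ ∈ interlacing l ↔ ∀ i, l i.succ ≤ μ i ∧ μ i ≤ l i.castSucc := by
  simp [interlacing]

lemma antitone_of_mem_interlacing {k : ℕ} {l : Fin (k + 1) → ℕ} (hl : Antitone l)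
    {μ : Fin k → ℕ} (hμ : μ ∈ interlacing l) : Antitone μ := by
  rw [mem_interlacing] at hμ
  intro i j hij
  rcases hij.eq_or_lt with rfl | hij
  · exact le_rfl
  · exact ((hμ j).2.trans (hl (by rw [Fin.le_def]; simp; omega))).trans (hμ i).1

lemma IsSSYT.le_apply {k : ℕ} {l : Fin k → ℕ} (hl : Antitone l) {T : Fin k × ℕ → ℕ}
    (hT : IsSSYT k l T) (i : Fin k) {j : ℕ} (hj : j < l i) : (i : ℕ) ≤ T (i, j) := by
  obtain ⟨i, hi⟩ := i
  induction i with
  | zero => simp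
  | succ i ih =>
    have hlt : (⟨i, by omega⟩ : Fin k) < ⟨i + 1, hi⟩ := by simp
    have h1 := hT.2.1 _ _ j hlt hj
    have h2 := ih (by omega) (hj.trans_le (hl hlt.le))
    simp only at h1 h2 ⊢
    omega

lemma isSSYT_extendTableau {k : ℕ} {l : Fin (k + 1) → ℕ} (hl : Antitone l)
    {μ : Fin k → ℕ} (hμ : μ ∈ interlacing l) {T : Fin k × ℕ → ℕ} (hT : IsSSYT k μ T) :
    IsSSYT (k + 1) l (extendTableau l μ T) := by
  rw [mem_interlacing] at hμ
  obtain ⟨h1, h2, h3, h4⟩ := hT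
  refine ⟨fun i => ?_, fun i1 i2 => ?_, fun i => ?_, fun i => ?_⟩
  · refine Fin.lastCases ?_ (fun i => ?_) i
    · intro j1 j2 h12 hj2
      simp only [extendTableau_last]
      rw [if_pos (h12.trans_lt hj2), if_pos hj2]
    · intro j1 j2 h12 hj2
      simp only [extendTableau_castSucc]
      have := h1 i j1 j2 h12
      have := h3 i j1
      split_ifs <;> omega
  · refine Fin.lastCases ?_ (fun i2 => ?_) i2
    · refine Fin.lastCases ?_ (fun i1 => ?_) i1
      · intro j h; simp at h
      · intro j _ hj
        have h5 : j < μ i1 := hj.trans_le ((hl (Fin.le_last _)).trans (hμ i1).1)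
        simp only [extendTableau_castSucc, extendTableau_last, if_pos hj, if_pos h5]
        exact h3 _ _ h5
    · refine Fin.lastCases ?_ (fun i1 => ?_) i1
      · intro j h; exact absurd h (by simp [Fin.lt_def])
      · intro j h hj
        have h : i1 < i2 := by simpa using h
        have h5 : j < μ i1 := hj.trans_le
          ((hl (by rw [Fin.le_def]; simp; omega)).trans (hμ i1).1)
        simp only [extendTableau_castSucc, if_pos hj, if_pos h5]
        split_ifs with h6
        · exact h2 _ _ _ h h6
        · exact h3 _ _ h5
  · refine Fin.lastCases ?_ (fun i => ?_) i
    · intro j hj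
      simp [extendTableau_last, hj]
    · intro j hj
      have := h3 i j
      simp only [extendTableau_castSucc]
      split_ifs <;> omega
  · refine Fin.lastCases ?_ (fun i => ?_) i
    · intro j hj
      simp [extendTableau_last, hj]
    · intro j hj
      have := hμ i
      simp only [extendTableau_castSucc]
      split_ifs <;> omega

lemma exists_extendTableau_eq {k : ℕ} {l : Fin (k + 1) → ℕ} (hl : Antitone l)
    {T : Fin (k + 1) × ℕ → ℕ} (hT : IsSSYT (k + 1) l T) :
    ∃ μ ∈ interlacing l, ∃ U, IsSSYT k μ U ∧ extendTableau l μ U = T := by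
  have hlast := fun j => hT.le_apply hl (Fin.last k) (j := j)
  obtain ⟨h1, h2, h3, h4⟩ := hT
  have hex : ∀ i : Fin k, ∃ n, ∀ j, j < n ↔ j < l i.castSucc ∧ T (i.castSucc, j) < k := by
    intro i
    have he : ∃ j, l i.castSucc ≤ j ∨ k ≤ T (i.castSucc, j) := ⟨_, Or.inl le_rfl⟩
    refine ⟨Nat.find he, fun j => ?_⟩
    rw [Nat.lt_find_iff]
    constructor
    · intro h
      simpa using h j le_rfl
    · rintro ⟨ha, hb⟩ j' hj'
      have := h1 i.castSucc j' j hj' ha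
      omega
  choose μ hμ using hex
  have hint : ∀ i, l i.succ ≤ μ i ∧ μ i ≤ l i.castSucc := by
    intro i
    constructor
    · by_contra! h
      have h5 := h2 i.castSucc i.succ (μ i) Fin.castSucc_lt_succ h
      have h6 := h3 i.succ _ h
      have h7 := hl (Fin.castSucc_lt_succ (i := i)).le
      exact lt_irrefl _ ((hμ i (μ i)).2 ⟨by omega, by omega⟩)
    · by_contra! h
      exact lt_irrefl _ ((hμ i _).1 h).1
  refine ⟨μ, mem_interlacing.2 hint,
    fun c => if c.2 < μ c.1 then T (c.1.castSucc, c.2) else 0, ⟨?_, ?_, ?_, ?_⟩, ?_⟩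
  · intro i j1 j2 h12 hj
    simp only [if_pos hj, if_pos (h12.trans_lt hj)]
    exact h1 _ _ _ h12 ((hμ i j2).1 hj).1
  · intro i1 i2 j h12 hj
    have h5 : j < μ i1 := (hj.trans_le (hint i2).2).trans_le
      ((hl (by rw [Fin.le_def]; simp; omega)).trans (hint i1).1)
    simp only [if_pos hj, if_pos h5]
    exact h2 _ _ _ (by simpa using h12) ((hμ i2 j).1 hj).1
  · intro i j hj
    simp only [if_pos hj]
    exact ((hμ i j).1 hj).2
  · intro i j hj
    simp [hj]
  · funext ⟨i, j⟩
    induction i using Fin.lastCases with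
    | last =>
      rw [extendTableau_last]
      split_ifs with h
      · have h5 := hlast j h
        have h6 := h3 _ _ h
        simp only [Fin.val_last] at h5
        omega
      · exact (h4 _ _ (by omega)).symm
    | cast i =>
      rw [extendTableau_castSucc]
      have h5 := hμ i j
      have h6 := h3 i.castSucc j
      have h7 := h4 i.castSucc j
      dsimp only
      split_ifs <;> omega

lemma setOf_isSSYT_succ {k : ℕ} {l : Fin (k + 1) → ℕ} (hl : Antitone l) :
    {T | IsSSYT (k + 1) l T} =
      ⋃ μ ∈ (interlacing l : Set (Fin k → ℕ)), extendTableau l μ '' {T | IsSSYT k μ T} := by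
  ext T
  simp only [Set.mem_ofPred_eq, Set.mem_iUnion, Set.mem_image, Finset.mem_coe, exists_prop]
  constructor
  · exact exists_extendTableau_eq hl
  · rintro ⟨μ, hμ, U, hU, rfl⟩
    exact isSSYT_extendTableau hl hμ hU

lemma finite_setOf_isSSYT {k : ℕ} {l : Fin k → ℕ} (hl : Antitone l) :
    {T | IsSSYT k l T}.Finite := by
  induction k with
  | zero => exact Set.toFinite _
  | succ k ih =>
    rw [setOf_isSSYT_succ hl]
    exact (Finset.finite_toSet _).biUnion fun μ hμ =>
      (ih (antitone_of_mem_interlacing hl hμ)).image _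

lemma extendTableau_injOn {k : ℕ} (l : Fin (k + 1) → ℕ) (μ : Fin k → ℕ) :
    Set.InjOn (extendTableau l μ) {T | IsSSYT k μ T} := by
  intro T hT U hU h
  funext ⟨i, j⟩
  have h1 := congrFun h (i.castSucc, j)
  have h2 := hT.2.2.2 i j
  have h3 := hU.2.2.2 i j
  simp only [extendTableau_castSucc] at h1
  split_ifs at h1 <;> omega

lemma extendTableau_pairwiseDisjoint {k : ℕ} (l : Fin (k + 1) → ℕ) :
    (interlacing l : Set (Fin k → ℕ)).PairwiseDisjoint
      fun μ => extendTableau l μ '' {T | IsSSYT k μ T} := by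
  have aux : ∀ μ ∈ interlacing l, ∀ ν ∈ interlacing l, ∀ T U, IsSSYT k μ T → IsSSYT k ν U →
      extendTableau l μ T = extendTableau l ν U → ∀ i, ν i ≤ μ i := by
    intro μ hμ ν hν T U hT hU h i
    by_contra! hlt
    have h1 := congrFun h (i.castSucc, μ i)
    have h2 := (mem_interlacing.1 hν i).2
    have h3 := hU.2.2.1 i _ hlt
    rw [extendTableau_castSucc, extendTableau_castSucc, if_neg (lt_irrefl _), if_pos hlt,
      if_pos (by omega)] at h1
    omega
  intro μ hμ ν hν hne
  rw [Function.onFun, Set.disjoint_left]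
  rintro _ ⟨T, hT, rfl⟩ ⟨U, hU, h⟩
  exact hne (funext fun i => le_antisymm (aux ν hν μ hμ U T hU hT h i)
    (aux μ hμ ν hν T U hT hU h.symm i))

lemma ncard_extendTableau_castSucc {k : ℕ} {l : Fin (k + 1) → ℕ} {μ : Fin k → ℕ}
    (hμ : μ ∈ interlacing l) (T : Fin k × ℕ → ℕ) (v : Fin k) :
    {c : Fin (k + 1) × ℕ | c.2 < l c.1 ∧ extendTableau l μ T c = (v.castSucc : ℕ)}.ncard =
      {c : Fin k × ℕ | c.2 < μ c.1 ∧ T c = (v : ℕ)}.ncard := by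
  rw [← Set.ncard_image_of_injective _
    ((Fin.castSucc_injective k).prodMap Function.injective_id)]
  congr 1
  ext ⟨i, j⟩
  have hv := v.2
  induction i using Fin.lastCases with
  | last =>
    by_cases hj : j < l (Fin.last k) <;> simp [extendTableau_last, hj]
    omega
  | cast i =>
    have := mem_interlacing.1 hμ i
    simp [extendTableau_castSucc]
    split_ifs <;> simp [*] <;> omega

lemma ncard_extendTableau_last {k : ℕ} {l : Fin (k + 1) → ℕ} {μ : Fin k → ℕ}
    {T : Fin k × ℕ → ℕ} (hT : IsSSYT k μ T) :
    {c : Fin (k + 1) × ℕ | c.2 < l c.1 ∧ extendTableau l μ T c = (Fin.last k : ℕ)}.ncard =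
      l (Fin.last k) + ∑ i, (l i.castSucc - μ i) := by
  have hset : {c : Fin (k + 1) × ℕ | c.2 < l c.1 ∧ extendTableau l μ T c = (Fin.last k : ℕ)} =
      (Equiv.sigmaEquivProd (Fin (k + 1)) ℕ) '' (Finset.univ.sigma fun i =>
        Finset.Ico (Fin.snoc (α := fun _ => ℕ) μ 0 i) (l i) : Finset (Σ _ : Fin (k + 1), ℕ)) := by
    ext ⟨i, j⟩
    rw [Equiv.image_eq_preimage_symm]
    induction i using Fin.lastCases with
    | last => simp +contextual [extendTableau_last]
    | cast i =>
      have := hT.2.2.1 i j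
      simp [extendTableau_castSucc]
      split_ifs <;> omega
  rw [hset, Set.ncard_image_of_injective _ (Equiv.injective _), Set.ncard_coe_finset,
    Finset.card_sigma, Fin.sum_univ_castSucc]
  simp [add_comm]

lemma schur_succ {k : ℕ} {l : Fin (k + 1) → ℕ} (hl : Antitone l) (x : Fin (k + 1) → ℝ) :
    schur (k + 1) l x = ∑ μ ∈ interlacing l,
      x (Fin.last k) ^ (l (Fin.last k) + ∑ i, (l i.castSucc - μ i)) *
        schur k μ (fun i => x i.castSucc) := by
  rw [schur, setOf_isSSYT_succ hl, finsum_mem_biUnion (extendTableau_pairwiseDisjoint l)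
    (Finset.finite_toSet _) fun μ hμ =>
      (finite_setOf_isSSYT (antitone_of_mem_interlacing hl hμ)).image _,
    finsum_mem_coe_finset]
  refine Finset.sum_congr rfl fun μ hμ => ?_
  rw [finsum_mem_image (extendTableau_injOn l μ), schur,
    mul_finsum_mem]
  refine finsum_mem_congr rfl fun T hT => ?_
  rw [Fin.prod_univ_castSucc, ncard_extendTableau_last hT, mul_comm]
  simp only [ncard_extendTableau_castSucc hμ]

lemma schur_zero (l : Fin 0 → ℕ) (x : Fin 0 → ℝ) : schur 0 l x = 1 := by
  have : {T | IsSSYT 0 l T} = {fun _ => 0} := by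
    ext T
    simp [IsSSYT, eq_iff_true_of_subsingleton]
  rw [schur, this, finsum_mem_singleton]
  simp

lemma schur_eq_det_newtonCoeff {k : ℕ} {l : Fin k → ℕ} (hl : Antitone l) (x : Fin k → ℝ) :
    schur k l x = 
      Matrix.det (Matrix.of fun j r : Fin k => newtonCoeff k x (l j.rev + j) r) := by
  induction k with
  | zero => simp [schur_zero]
  | succ k ih =>
    have hmono : Monotone fun j : Fin (k + 1) => l j.rev + (j : ℕ) := fun i j hij =>
      add_le_add (hl (Fin.rev_le_rev.2 hij)) hij
    rw [schur_succ hl, det_newtonCoeff_succ x _ hmono, Finset.mul_sum]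
    refine Finset.sum_bij' (fun μ _ j => μ j.rev + j) (fun g _ i => g i.rev - i.rev) ?_ ?_ ?_ ?_ ?_
    · intro μ hμ
      rw [mem_interlacing] at hμ
      simp only [Fintype.mem_piFinset, Finset.mem_Ico, Fin.rev_castSucc, Fin.rev_succ]
      intro j
      have := hμ j.rev
      simp
      omega
    · intro g hg
      simp only [Fintype.mem_piFinset, Finset.mem_Ico, Fin.rev_castSucc, Fin.rev_succ] at hg
      rw [mem_interlacing]
      intro i
      have := hg i.rev
      simp at this ⊢
      omega
    · intro μ _
      simp
    · intro g hg
      simp only [Fintype.mem_piFinset, Finset.mem_Ico, Fin.rev_castSucc, Fin.rev_succ] at hg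
      funext j
      have := hg j
      simp at this ⊢
      omega
    · intro μ hμ
      rw [ih (antitone_of_mem_interlacing hl hμ), pow_add, mul_assoc, Finset.prod_pow_eq_pow_sum]
      simp only [Fin.rev_zero, Fin.val_zero, add_zero]
      congr 3
      rw [← Equiv.sum_comp Fin.revPerm]
      refine Finset.sum_congr rfl fun j _ => ?_
      simp [Fin.rev_succ]
      omega

open Polynomial in
/-- The Euler operator `X * d/dX`. -/
def eulerOp : ℝ[X] →ₗ[ℝ] ℝ[X] := LinearMap.mulLeft ℝ X ∘ₗ derivative

open Polynomial in
lemma eulerOp_pow_X_pow (t n : ℕ) : (eulerOp ^ t) ((X : ℝ[X]) ^ n) = (n : ℝ) ^ t • X ^ n := by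
  induction t with
  | zero => simp
  | succ t ih =>
    rw [pow_succ', Module.End.mul_apply, ih, map_smul, pow_succ, mul_smul]
    congr 1
    cases n with
    | zero => simp [eulerOp]
    | succ n =>
      simp only [eulerOp, LinearMap.comp_apply, LinearMap.mulLeft_apply, derivative_X_pow,
        smul_eq_C_mul, Nat.add_sub_cancel]
      ring

open Polynomial in
lemma eulerOp_X_sub_C_pow_mul (a : ℝ) (n : ℕ) (G : ℝ[X]) :
    eulerOp ((X - C a) ^ (n + 1) * G) =
      (X - C a) ^ n * (X * (C ((n : ℝ) + 1) * G + (X - C a) * derivative G)) := by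
  simp only [eulerOp, LinearMap.comp_apply, LinearMap.mulLeft_apply, derivative_mul,
    derivative_X_sub_C_pow, Nat.add_sub_cancel]
  simp
  ring

open Polynomial in
lemma eval_eulerOp_pow_of_lt (a : ℝ) {t n : ℕ} (h : t < n) (G : ℝ[X]) :
    ((eulerOp ^ t) ((X - C a) ^ n * G)).eval a = 0 := by
  induction t generalizing n G with
  | zero => simp [h.ne']
  | succ t ih =>
    obtain ⟨n, rfl⟩ := Nat.exists_eq_add_of_lt (Nat.zero_lt_of_lt h)
    rw [pow_succ, Module.End.mul_apply, eulerOp_X_sub_C_pow_mul]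
    exact ih (by omega) _

open Polynomial in
lemma eval_eulerOp_pow_self (a : ℝ) (t : ℕ) (G : ℝ[X]) :
    ((eulerOp ^ t) ((X - C a) ^ t * G)).eval a = a ^ t * t.factorial * G.eval a := by
  induction t generalizing G with
  | zero => simp
  | succ t ih =>
    rw [pow_succ, Module.End.mul_apply, eulerOp_X_sub_C_pow_mul, ih]
    simp [Nat.factorial_succ]
    ring

open Polynomial in
/-- Apply the `t`-th power of the Euler operator, evaluate at `a` and divide by `a ^ t`. -/
def eulerEval (a : ℝ) (t : ℕ) : ℝ[X] →ₗ[ℝ] ℝ :=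
  (a ^ t)⁻¹ • (leval a ∘ₗ eulerOp ^ t)

open Polynomial in
lemma eulerEval_X_pow {a : ℝ} (ha : a ≠ 0) (t n : ℕ) :
    eulerEval a t (X ^ n) = (n : ℝ) ^ t * a ^ ((n : ℤ) - t) := by
  simp only [eulerEval, LinearMap.smul_apply, LinearMap.comp_apply, eulerOp_pow_X_pow, leval_apply,
    eval_smul, eval_pow, eval_X, smul_eq_mul]
  rw [zpow_sub₀ ha, zpow_natCast, zpow_natCast]
  field_simp

open Polynomial in
lemma eulerEval_eq_zero_of_dvd {a : ℝ} {t : ℕ} {f : ℝ[X]} (h : (X - C a) ^ (t + 1) ∣ f) :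
    eulerEval a t f = 0 := by
  obtain ⟨G, rfl⟩ := h
  simp [eulerEval, eval_eulerOp_pow_of_lt a t.lt_succ_self G]

open Polynomial in
lemma eulerEval_X_sub_C_pow_mul {a : ℝ} (ha : a ≠ 0) (t : ℕ) (G : ℝ[X]) :
    eulerEval a t ((X - C a) ^ t * G) = t.factorial * G.eval a := by
  simp only [eulerEval, LinearMap.smul_apply, LinearMap.comp_apply, leval_apply,
    eval_eulerOp_pow_self, smul_eq_mul]
  field_simp

/-- The number of later positions in the block of `i`. -/
def blockRest {k m : ℕ} (b : Fin k → Fin m) (i : Fin k) : ℕ :=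
  (Finset.univ.filter fun i' : Fin k => i < i' ∧ b i' = b i).card

lemma sup_block_eq {k m : ℕ} {b : Fin k → Fin m} (hb : Monotone b) (i : Fin k) :
    ((Finset.univ.filter fun i' : Fin k => b i' = b i).sup fun i' => (i' : ℕ)) =
      i + blockRest b i := by
  have hne : (Finset.univ.filter fun i' : Fin k => b i' = b i).Nonempty := ⟨i, by simp⟩
  obtain ⟨s, hs, hsup⟩ := Finset.exists_mem_eq_sup _ hne fun i' : Fin k => (i' : ℕ)
  have hle : ∀ i', b i' = b i → i' ≤ s := fun i' hi' => by
    have := Finset.le_sup (f := fun i' : Fin k => (i' : ℕ))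
      (show i' ∈ Finset.univ.filter fun i' : Fin k => b i' = b i by simpa using hi')
    rw [hsup] at this
    exact this
  have hs' : b s = b i := by simpa using hs
  have hI : (Finset.univ.filter fun i' : Fin k => i < i' ∧ b i' = b i) = Finset.Ioc i s := by
    ext i'
    simp only [Finset.mem_filter, Finset.mem_univ, true_and, Finset.mem_Ioc]
    exact ⟨fun h => ⟨h.1, hle _ h.2⟩,
      fun h => ⟨h.1, le_antisymm (hs' ▸ hb h.2) (hb h.1.le)⟩⟩
  have := Fin.le_def.1 (hle i rfl)
  rw [hsup, blockRest, hI, Fin.card_Ioc]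
  omega

lemma blockRest_lt_of_lt {k m : ℕ} {b : Fin k → Fin m} {i j : Fin k} (h : i < j)
    (hij : b i = b j) : blockRest b j < blockRest b i := by
  refine Finset.card_lt_card (Finset.ssubset_iff_of_subset ?_ |>.2 ⟨j, ?_, ?_⟩)
  · intro a
    simp only [Finset.mem_filter, Finset.mem_univ, true_and, hij]
    exact fun ha => ⟨h.trans ha.1, ha.2⟩
  · simp [h, hij]
  · simp

lemma blockRest_injOn {k m : ℕ} (b : Fin k → Fin m) (α : Fin m) :
    Set.InjOn (blockRest b) (Finset.univ.filter fun i => b i = α) := by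
  intro i hi j hj h
  have hi : b i = α := by simpa using hi
  have hj : b j = α := by simpa using hj
  rcases lt_trichotomy i j with hij | hij | hij
  · exact absurd h (blockRest_lt_of_lt hij (hi.trans hj.symm)).ne'
  · exact hij
  · exact absurd h (blockRest_lt_of_lt hij (hj.trans hi.symm)).ne

lemma image_blockRest {k m : ℕ} (b : Fin k → Fin m) (α : Fin m) :
    (Finset.univ.filter fun i => b i = α).image (blockRest b) =
      Finset.range (Finset.univ.filter fun i => b i = α).card := by
  refine Finset.eq_of_subset_of_card_le ?_ ?_
  · intro t
    simp only [Finset.mem_image, Finset.mem_filter, Finset.mem_univ, true_and, Finset.mem_range]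
    rintro ⟨i, rfl, rfl⟩
    refine Finset.card_lt_card (Finset.ssubset_iff_of_subset ?_ |>.2 ⟨i, ?_, ?_⟩) <;>
      simp +contextual [Finset.subset_iff]
  · rw [Finset.card_range, Finset.card_image_of_injOn]
    exact blockRest_injOn b α

lemma prod_factorial_blockRest {k m : ℕ} (b : Fin k → Fin m) :
    ∏ i, ((blockRest b i).factorial : ℝ) =
      ∏ α, ∏ r ∈ Finset.range (Finset.univ.filter fun i => b i = α).card,
        (r.factorial : ℝ) := by
  rw [← Finset.prod_fiberwise Finset.univ b]
  refine Finset.prod_congr rfl fun α _ => ?_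
  rw [← image_blockRest, Finset.prod_image (blockRest_injOn b α)]

lemma prod_block_sub {k m : ℕ} (b : Fin k → Fin m) (p : Fin m → ℝ) :
    ∏ i, ∏ i' with b i < b i', (p (b i) - p (b i')) =
      ∏ q : Fin m × Fin m with q.1 < q.2, (p q.1 - p q.2) ^
        ((Finset.univ.filter fun i => b i = q.1).card *
          (Finset.univ.filter fun i => b i = q.2).card) := by
  have comp (f : Fin m → ℝ) :
      ∏ i, f (b i) = ∏ α, f α ^ (Finset.univ.filter fun i => b i = α).card := by
    rw [← Finset.prod_fiberwise Finset.univ b]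
    refine Finset.prod_congr rfl fun α _ => ?_
    rw [← Finset.prod_const]
    refine Finset.prod_congr rfl fun i hi => ?_
    rw [(Finset.mem_filter.1 hi).2]
  simp only [Finset.prod_filter]
  rw [comp fun α => ∏ i', if α < b i' then p α - p (b i') else 1, Fintype.prod_prod_type]
  refine Finset.prod_congr rfl fun α _ => ?_
  rw [comp fun β => if α < β then p α - p β else 1, ← Finset.prod_pow]
  refine Finset.prod_congr rfl fun β _ => ?_
  dsimp only
  split_ifs
  · rw [← pow_mul, mul_comm]
  · simp

open Polynomial in
lemma pow_blockRest_dvd {k m : ℕ} (b : Fin k → Fin m) (p : Fin m → ℝ) {i : Fin k}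
    {s : Finset (Fin k)} (hs : ∀ i', i ≤ i' → b i' = b i → i' ∈ s) :
    (X - C (p (b i))) ^ (blockRest b i + 1) ∣ ∏ i' ∈ s, (X - C (p (b i'))) := by
  have hnot : i ∉ Finset.univ.filter fun i' : Fin k => i < i' ∧ b i' = b i := by simp
  refine dvd_trans (dvd_of_eq ?_) (Finset.prod_dvd_prod_of_subset
    (insert i (Finset.univ.filter fun i' : Fin k => i < i' ∧ b i' = b i)) s _ ?_)
  · rw [blockRest, ← Finset.card_insert_of_notMem hnot, ← Finset.prod_const]
    refine Finset.prod_congr rfl fun i' hi' => ?_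
    simp only [Finset.mem_insert, Finset.mem_filter, Finset.mem_univ, true_and] at hi'
    rcases hi' with rfl | hi'
    · rfl
    · rw [hi'.2]
  · intro i' hi'
    simp only [Finset.mem_insert, Finset.mem_filter, Finset.mem_univ, true_and] at hi'
    rcases hi' with rfl | hi'
    · exact hs _ le_rfl rfl
    · exact hs _ hi'.1.le hi'.2

open Polynomial in
lemma det_eulerEval_newton {k m : ℕ} {b : Fin k → Fin m} (hb : Monotone b) {p : Fin m → ℝ}
    (hp : ∀ α, p α ≠ 0) :
    Matrix.det (Matrix.of fun i r : Fin k => eulerEval (p (b i)) (blockRest b i)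
        (∏ i' with r < i', (X - C (p (b i'))))) =
      ∏ i, ((blockRest b i).factorial * ∏ i' with b i < b i', (p (b i) - p (b i'))) := by
  rw [Matrix.det_of_isUpperTriangular]
  · refine Finset.prod_congr rfl fun i _ => ?_
    have hsplit : ∏ i' with i < i', (X - C (p (b i'))) =
        (X - C (p (b i))) ^ blockRest b i * ∏ i' with b i < b i', (X - C (p (b i'))) := by
      rw [← Finset.prod_filter_mul_prod_filter_not _ fun i' => b i' = b i, Finset.filter_filter,
        Finset.filter_filter, blockRest, ← Finset.prod_const]
      congr 1
      · refine Finset.prod_congr rfl fun i' hi' => ?_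
        rw [(Finset.mem_filter.1 hi').2.2]
      · refine Finset.prod_congr (Finset.filter_congr fun i' _ => ?_) fun _ _ => rfl
        exact ⟨fun h => lt_of_le_of_ne (hb h.1.le) (Ne.symm h.2), fun h => ⟨hb.reflect_lt h, h.ne'⟩⟩
    rw [Matrix.of_apply, hsplit, eulerEval_X_sub_C_pow_mul (hp _), eval_prod]
    simp
  · intro i r hri
    rw [Matrix.of_apply]
    refine eulerEval_eq_zero_of_dvd (pow_blockRest_dvd b p ?_)
    intro i' h _
    simpa using lt_of_lt_of_le hri h

open Polynomial in
lemma eulerEval_X_pow_eq_sum {k m : ℕ} (b : Fin k → Fin m) (p : Fin m → ℝ) (i : Fin k) (n : ℕ) :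
    eulerEval (p (b i)) (blockRest b i) (X ^ n) =
      ∑ r : Fin k, eulerEval (p (b i)) (blockRest b i) (∏ i' with r < i', (X - C (p (b i')))) *
        newtonCoeff k (fun i => p (b i)) n r.rev := by
  have h := eulerEval_eq_zero_of_dvd ((pow_blockRest_dvd b p (i := i) (s := Finset.univ)
    fun _ _ _ => Finset.mem_univ _).trans
      (prod_dvd_X_pow_sub_sum_newtonCoeff k (fun i => p (b i)) n))
  rw [map_sub, sub_eq_zero, map_sum] at h
  rw [h, ← Equiv.sum_comp Fin.revPerm]
  refine Finset.sum_congr rfl fun r _ => ?_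
  rw [← smul_eq_C_mul, map_smul, smul_eq_mul, mul_comm]
  simp [Fin.rev_lt_rev]

open Polynomial in
lemma det_eulerEval_X_pow {k m : ℕ} {b : Fin k → Fin m} (hb : Monotone b) {p : Fin m → ℝ}
    (hp : ∀ α, p α ≠ 0) {l : Fin k → ℕ} (hl : Antitone l) :
    Matrix.det (Matrix.of fun i j : Fin k =>
        eulerEval (p (b i)) (blockRest b i) (X ^ (l j + (k - 1 - (j : ℕ))))) =
      (∏ i, ((blockRest b i).factorial * ∏ i' with b i < b i', (p (b i) - p (b i')))) *
        schur k l fun i => p (b i) := by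
  rw [← det_eulerEval_newton hb hp, schur_eq_det_newtonCoeff hl,
    ← Matrix.det_submatrix_equiv_self Fin.revPerm (Matrix.of fun j r : Fin k =>
      newtonCoeff k (fun i => p (b i)) (l j.rev + j) r),
    ← Matrix.det_transpose (Matrix.submatrix _ _ _), ← Matrix.det_mul]
  congr 1
  ext i j
  rw [Matrix.of_apply, eulerEval_X_pow_eq_sum, Matrix.mul_apply]
  refine Finset.sum_congr rfl fun r _ => ?_
  have : k - 1 - (j : ℕ) = k - (j + 1) := by omega
  simp [this]

/-- Schur polynomial at repeated arguments: with distinct positive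
values `p₁ > ⋯ > p_m` of multiplicities `k₁,…,k_m` (`k = Σ k_α`), blocks encoded by a
monotone surjection `b : Fin k → Fin m` with fibers of cardinality `k_α`,
`i_α = max A_α`, and `h_j = λ_j + k - j` (here `0`-indexed: `h_j = λ_j + (k-1) - j`),
`s_λ(q) = det(B)/Δ'(p)` where `B_{ij} = h_j^{i_α-i} p_α^{h_j-i_α+i}` for `i ∈ A_α`
and `Δ'(p) = ∏_α 1!2!⋯(k_α-1)! ∏_{α<β}(p_α-p_β)^{k_αk_β}`. -/
theorem schur_repeated_arguments_det_formula
    (m : ℕ) (hm : 0 < m) (p : Fin m → ℝ) (hppos : ∀ α, 0 < p α)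
    (hdec : StrictAnti p)
    (kk : Fin m → ℕ) (hkk : ∀ α, 1 ≤ kk α)
    (k : ℕ) (hk : k = ∑ α, kk α)
    (b : Fin k → Fin m) (hb : Monotone b)
    (hfib : ∀ α : Fin m, (Finset.univ.filter fun i : Fin k => b i = α).card = kk α)
    (l : Fin k → ℕ) (hl : Antitone l) :
    schur k l (fun i => p (b i)) =
      Matrix.det (Matrix.of fun i j : Fin k =>
        ((l j + (k - 1 - (j : ℕ)) : ℕ) : ℝ) ^
            (((Finset.univ.filter fun i' : Fin k => b i' = b i).sup
                fun i' => (i' : ℕ)) - (i : ℕ)) *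
          p (b i) ^
            (((l j + (k - 1 - (j : ℕ)) : ℕ) : ℤ) -
              ((((Finset.univ.filter fun i' : Fin k => b i' = b i).sup
                  fun i' => (i' : ℕ) : ℕ)) : ℤ) + (i : ℤ))) /
      ((∏ α : Fin m, ∏ r ∈ Finset.range (kk α), (Nat.factorial r : ℝ)) *
        ∏ q ∈ Finset.univ.filter fun q : Fin m × Fin m => q.1 < q.2,
          (p q.1 - p q.2) ^ (kk q.1 * kk q.2)) := by
  have hp : ∀ α, p α ≠ 0 := fun α => (hppos α).ne'
  have hΔ : (∏ α : Fin m, ∏ r ∈ Finset.range (kk α), (Nat.factorial r : ℝ)) *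
      ∏ q ∈ Finset.univ.filter fun q : Fin m × Fin m => q.1 < q.2,
        (p q.1 - p q.2) ^ (kk q.1 * kk q.2) ≠ 0 := by
    refine mul_ne_zero (Finset.prod_ne_zero_iff.2 fun α _ => Finset.prod_ne_zero_iff.2 fun r _ =>
      Nat.cast_ne_zero.2 r.factorial_ne_zero) (Finset.prod_ne_zero_iff.2 fun q hq => pow_ne_zero _ ?_)
    exact sub_ne_zero.2 (hdec (Finset.mem_filter.1 hq).2).ne'
  have hdet := det_eulerEval_X_pow hb hp hl
  rw [Finset.prod_mul_distrib, prod_factorial_blockRest, prod_block_sub] at hdet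
  simp only [hfib] at hdet
  rw [eq_div_iff hΔ, mul_comm, ← hdet]
  congr 1
  ext i j
  simp only [Matrix.of_apply]
  rw [eulerEval_X_pow (hp _), sup_block_eq hb, Nat.add_sub_cancel_left]
  congr 2
  push_cast
  ring

end
end
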